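/- arXiv:1602.09132 — 13 statements merged into one kernel-verified Lean document; each statement's English description precedes it below -/
import Mathlib

section
/- For real numbers 0 ≤ s ≤ x, the following three expressions are equal: (i) 2·∑_{0≤a≤b, a+b even} (−1)^{(b−a)/2} C(b,(a+b)/2) x^a s^b/(a!·b!) + ∑_{0≤a≤b−1, a+b odd} (−1)^{(b−a−1)/2} C(b,(a+b+1)/2) x^a s^b/(a!·b!) + ∑_{0≤a≤b+1, a+b odd} (−1)^{(b−a+1)/2} C(b,(b−a+1)/2) x^a s^b/(a!·b!); (ii) 2·∑_{n=0}^∞ s^n(x−s)^n/(n!·n!) + x·∑_{n=0}^∞ s^n(x−s)^n/(n!·(n+1)!); (iii) ∑_{n=0}^∞ (x+2n+2)·s^n(x−s)^n/(n!·(n+1)!). In particular each equals the continuous binomial coefficient {x brace s}. -/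
/-- The continuous binomial coefficient `{x brace s}`. -/
noncomputable def contBinom (x s : ℝ) : ℝ :=
  ∑' n : ℕ, (x + 2 * n + 2) * s ^ n * (x - s) ^ n /
    ((Nat.factorial n : ℝ) * (Nat.factorial (n + 1) : ℝ))

open Finset in
lemma cb_tsum_reindex (F : ℕ × ℕ → ℝ) (hF : Summable F) (i : ℕ × ℕ → ℕ × ℕ)
    (hi : Function.Injective i) (hsupp : Function.support F ⊆ Set.range i) :
    ∑' p, F p = ∑' n : ℕ, ∑ p ∈ Finset.HasAntidiagonal.antidiagonal n, F (i p) := by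
  rw [← hi.tsum_eq hsupp]
  have h1 : Summable (fun p => F (i p)) := hF.comp_injective hi
  rw [← (Finset.HasAntidiagonal.sigmaAntidiagonalEquivProd (A := ℕ)).tsum_eq (fun p => F (i p))]
  have h2 := ((Finset.HasAntidiagonal.sigmaAntidiagonalEquivProd (A := ℕ)).summable_iff).2 h1
  refine (Summable.tsum_sigma' (fun n => (hasSum_fintype _).summable) h2).trans ?_
  congr 1; ext n
  rw [tsum_fintype]
  simp only [Function.comp, Finset.HasAntidiagonal.sigmaAntidiagonalEquivProd_apply]
  exact Finset.sum_coe_sort (Finset.HasAntidiagonal.antidiagonal n) (fun p => F (i p))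

lemma cb_summable (x s : ℝ) (P : ℕ × ℕ → Prop) [DecidablePred P] (e c : ℕ × ℕ → ℕ) :
    Summable (fun ab : ℕ × ℕ => if P ab then
      (-1 : ℝ) ^ (e ab) * (Nat.choose ab.2 (c ab)) * x ^ ab.1 * s ^ ab.2 /
            ((Nat.factorial ab.1 : ℝ) * (Nat.factorial ab.2 : ℝ)) else 0) := by
  have h := (Real.summable_pow_div_factorial |x|).mul_of_nonneg
    (Real.summable_pow_div_factorial (2 * |s|)) (fun n => by positivity) (fun n => by positivity)
  refine Summable.of_norm_bounded h ?_
  rintro ⟨a, b⟩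
  have hc : ((Nat.choose b (c (a, b)) : ℕ) : ℝ) ≤ 2 ^ b := by
    exact_mod_cast Nat.choose_le_two_pow b _
  split_ifs
  · simp only [norm_mul, norm_div, norm_pow, Real.norm_eq_abs, abs_neg, abs_one, one_pow, one_mul,
      Nat.abs_cast]
    rw [div_mul_div_comm, mul_pow]
    rw [show |x| ^ a * (2 ^ b * |s| ^ b) = 2 ^ b * |x| ^ a * |s| ^ b by ring]
    gcongr
  · simp only [norm_zero]; positivity

lemma cb_choose (k j : ℕ) : ((Nat.choose (k + j) k : ℕ) : ℝ) =
    (Nat.factorial (k + j) : ℝ) / (Nat.factorial k * Nat.factorial j) := by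
  rw [Nat.cast_choose ℝ (Nat.le_add_right k j), Nat.add_sub_cancel_left]

lemma cb_sum1 (x s : ℝ) (m : ℕ) (d : ℝ) :
    ∑ p ∈ Finset.HasAntidiagonal.antidiagonal m, (-1 : ℝ) ^ p.2 * x ^ p.1 * s ^ (p.1 + 2 * p.2) /
      (Nat.factorial p.1 * Nat.factorial p.2 * d) =
    s ^ m * (x - s) ^ m / (Nat.factorial m * d) := by
  rw [sub_eq_add_neg, (Commute.all x (-s)).add_pow', Finset.mul_sum, Finset.sum_div]
  refine Finset.sum_congr rfl ?_
  rintro ⟨k, j⟩ h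
  obtain rfl : k + j = m := by simpa using h
  simp only [nsmul_eq_mul]
  rw [cb_choose]
  have h1 : (Nat.factorial (k + j) : ℝ) ≠ 0 := by positivity
  have h2 : (Nat.factorial k : ℝ) ≠ 0 := by positivity
  have h3 : (Nat.factorial j : ℝ) ≠ 0 := by positivity
  by_cases hd : d = 0
  · simp [hd]
  rw [neg_pow s]
  field_simp
  ring

lemma cb_summable1 (y : ℝ) (r : ℕ) : Summable (fun n : ℕ => y ^ n /
    ((Nat.factorial n : ℝ) * (Nat.factorial (n + r) : ℝ))) := by
  refine Summable.of_norm_bounded (Real.summable_pow_div_factorial |y|) ?_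
  intro n
  simp only [norm_mul, norm_div, norm_pow, Real.norm_eq_abs, Nat.abs_cast]
  have : (1 : ℝ) ≤ Nat.factorial (n + r) := by exact_mod_cast Nat.factorial_pos _
  gcongr
  exact le_mul_of_one_le_right (by positivity) this

lemma cb_ii_iii (x s : ℝ) : 2 * (∑' n : ℕ, s ^ n * (x - s) ^ n /
            ((Nat.factorial n : ℝ) * (Nat.factorial n : ℝ))) +
      x * (∑' n : ℕ, s ^ n * (x - s) ^ n /
            ((Nat.factorial n : ℝ) * (Nat.factorial (n + 1) : ℝ)))
      = ∑' n : ℕ, (x + 2 * n + 2) * s ^ n * (x - s) ^ n /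
          ((Nat.factorial n : ℝ) * (Nat.factorial (n + 1) : ℝ)) := by
  have h0 := cb_summable1 (s * (x - s)) 0
  have h1 := cb_summable1 (s * (x - s)) 1
  simp only [mul_pow, add_zero] at h0 h1
  rw [← tsum_mul_left, ← tsum_mul_left, ← (h0.mul_left 2).tsum_add (h1.mul_left x)]
  congr 1; ext n
  rw [Nat.factorial_succ]
  push_cast
  field_simp
  ring

lemma cb_even (x s : ℝ) : (∑' ab : ℕ × ℕ,
        if ab.1 ≤ ab.2 ∧ Even (ab.1 + ab.2) then
          (-1 : ℝ) ^ ((ab.2 - ab.1) / 2) * (Nat.choose ab.2 ((ab.1 + ab.2) / 2)) *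
            x ^ ab.1 * s ^ ab.2 /
            ((Nat.factorial ab.1 : ℝ) * (Nat.factorial ab.2 : ℝ))
        else 0) = ∑' n : ℕ, s ^ n * (x - s) ^ n /
              ((Nat.factorial n : ℝ) * (Nat.factorial n : ℝ)) := by
  rw [cb_tsum_reindex _ (cb_summable x s (fun ab => ab.1 ≤ ab.2 ∧ Even (ab.1 + ab.2)) _ _)
    (fun p => (p.1, p.1 + 2 * p.2))]
  · congr 1; ext n
    rw [← cb_sum1]
    refine Finset.sum_congr rfl ?_
    rintro ⟨k, j⟩ h
    obtain rfl : k + j = n := by simpa using h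
    dsimp only
    rw [if_pos ⟨by omega, ⟨k + j, by omega⟩⟩]
    have e1 : (k + 2 * j - k) / 2 = j := by omega
    have e2 : (k + (k + 2 * j)) / 2 = k + j := by omega
    rw [e1, e2]
    have e3 : k + 2 * j = (k + j) + j := by ring
    have e4 := cb_choose (k + j) j
    rw [← e3] at e4
    rw [e4]
    have : (Nat.factorial (k + 2 * j) : ℝ) ≠ 0 := by positivity
    field_simp
  · rintro ⟨a, b⟩ ⟨c, d⟩ h
    simp only [Prod.mk.injEq] at h ⊢
    omega
  · rintro ⟨a, b⟩ h
    simp only [Function.mem_support, ne_eq, ite_eq_right_iff, Classical.not_imp] at h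
    obtain ⟨⟨h1, ⟨r, h2⟩⟩, -⟩ := h
    exact ⟨(a, r - a), by apply Prod.ext <;> dsimp only <;> omega⟩

lemma cb_odd (x s : ℝ) : (∑' ab : ℕ × ℕ,
        if ab.1 ≤ ab.2 - 1 ∧ 1 ≤ ab.2 ∧ Odd (ab.1 + ab.2) then
          (-1 : ℝ) ^ ((ab.2 - ab.1 - 1) / 2) * (Nat.choose ab.2 ((ab.1 + ab.2 + 1) / 2)) *
            x ^ ab.1 * s ^ ab.2 /
            ((Nat.factorial ab.1 : ℝ) * (Nat.factorial ab.2 : ℝ))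
        else 0) +
      (∑' ab : ℕ × ℕ,
        if ab.1 ≤ ab.2 + 1 ∧ Odd (ab.1 + ab.2) then
          (-1 : ℝ) ^ ((ab.2 - ab.1 + 1) / 2) * (Nat.choose ab.2 ((ab.2 - ab.1 + 1) / 2)) *
            x ^ ab.1 * s ^ ab.2 /
            ((Nat.factorial ab.1 : ℝ) * (Nat.factorial ab.2 : ℝ))
        else 0) = x * (∑' n : ℕ, s ^ n * (x - s) ^ n /
              ((Nat.factorial n : ℝ) * (Nat.factorial (n + 1) : ℝ))) := by
  have s2 := cb_summable x s (fun ab => ab.1 ≤ ab.2 - 1 ∧ 1 ≤ ab.2 ∧ Odd (ab.1 + ab.2))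
    (fun ab => (ab.2 - ab.1 - 1) / 2) (fun ab => (ab.1 + ab.2 + 1) / 2)
  have s3 := cb_summable x s (fun ab => ab.1 ≤ ab.2 + 1 ∧ Odd (ab.1 + ab.2))
    (fun ab => (ab.2 - ab.1 + 1) / 2) (fun ab => (ab.2 - ab.1 + 1) / 2)
  rw [← s2.tsum_add s3, cb_tsum_reindex _ (s2.add s3) (fun p => (p.1 + 1, p.1 + 2 * p.2)),
    ← tsum_mul_left]
  · congr 1; ext n
    rw [← cb_sum1, Finset.mul_sum]
    refine Finset.sum_congr rfl ?_
    rintro ⟨k, j⟩ h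
    obtain rfl : k + j = n := by simpa using h
    dsimp only
    have ho : Odd (k + 1 + (k + 2 * j)) := ⟨k + j, by omega⟩
    rw [if_pos (show k + 1 ≤ k + 2 * j + 1 ∧ Odd (k + 1 + (k + 2 * j)) from ⟨by omega, ho⟩)]
    have e1 : (k + 2 * j - (k + 1) + 1) / 2 = j := by omega
    rw [e1]
    have e4 := cb_choose j (k + j)
    rw [show j + (k + j) = k + 2 * j by ring] at e4
    rw [e4]
    have : (Nat.factorial (k + 2 * j) : ℝ) ≠ 0 := by positivity
    rcases j with _ | j
    · rw [if_neg (by omega)]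
      simp only [Nat.factorial_succ, add_zero, mul_zero, Nat.factorial_zero]
      push_cast
      simp only [mul_zero, add_zero] at this
      field_simp
      ring
    · rw [if_pos ⟨by omega, by omega, ho⟩]
      have e5 : (k + 2 * (j + 1) - (k + 1) - 1) / 2 = j := by omega
      have e6 : (k + 1 + (k + 2 * (j + 1)) + 1) / 2 = k + j + 2 := by omega
      have e7 := cb_choose (k + j + 2) j
      rw [show k + j + 2 + j = k + 2 * (j + 1) by ring] at e7
      rw [e5, e6, e7]
      generalize k + 2 * (j + 1) = N at *
      rw [show k + (j + 1) = k + j + 1 by ring]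
      simp only [Nat.factorial_succ]
      push_cast
      field_simp
      ring
  · rintro ⟨a, b⟩ ⟨c, d⟩ h
    simp only [Prod.mk.injEq] at h ⊢
    omega
  · rintro ⟨a, b⟩ h
    by_contra hne
    apply h
    dsimp only
    by_cases ho : Odd (a + b)
    swap
    · rw [if_neg (by tauto), if_neg (by tauto), add_zero]
    obtain ⟨r, hr⟩ := id ho
    by_cases hab : a ≤ b + 1
    swap
    · rw [if_neg (by omega), if_neg (by omega), add_zero]
    rcases a with _ | a
    · rw [if_pos ⟨by omega, by omega, ho⟩, if_pos ⟨by omega, ho⟩]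
      obtain rfl : b = 2 * r + 1 := by omega
      have e1 : (2 * r + 1 - 0 - 1) / 2 = r := by omega
      have e2 : (0 + (2 * r + 1) + 1) / 2 = r + 1 := by omega
      have e3 : (2 * r + 1 - 0 + 1) / 2 = r + 1 := by omega
      rw [e1, e2, e3]
      ring
    · exact absurd ⟨(a, r - a), by apply Prod.ext <;> dsimp only <;> omega⟩ hne

/-- For `0 ≤ s ≤ x` the three expressions (i), (ii), (iii) for the
continuous binomial coefficient agree, and each equals `{x brace s}`. -/
theorem contBinom_three_expressions (x s : ℝ) (hs : 0 ≤ s) (hsx : s ≤ x) :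
    (2 * (∑' ab : ℕ × ℕ,
        if ab.1 ≤ ab.2 ∧ Even (ab.1 + ab.2) then
          (-1 : ℝ) ^ ((ab.2 - ab.1) / 2) * (Nat.choose ab.2 ((ab.1 + ab.2) / 2)) *
            x ^ ab.1 * s ^ ab.2 /
            ((Nat.factorial ab.1 : ℝ) * (Nat.factorial ab.2 : ℝ))
        else 0) +
      (∑' ab : ℕ × ℕ,
        if ab.1 ≤ ab.2 - 1 ∧ 1 ≤ ab.2 ∧ Odd (ab.1 + ab.2) then
          (-1 : ℝ) ^ ((ab.2 - ab.1 - 1) / 2) * (Nat.choose ab.2 ((ab.1 + ab.2 + 1) / 2)) *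
            x ^ ab.1 * s ^ ab.2 /
            ((Nat.factorial ab.1 : ℝ) * (Nat.factorial ab.2 : ℝ))
        else 0) +
      (∑' ab : ℕ × ℕ,
        if ab.1 ≤ ab.2 + 1 ∧ Odd (ab.1 + ab.2) then
          (-1 : ℝ) ^ ((ab.2 - ab.1 + 1) / 2) * (Nat.choose ab.2 ((ab.2 - ab.1 + 1) / 2)) *
            x ^ ab.1 * s ^ ab.2 /
            ((Nat.factorial ab.1 : ℝ) * (Nat.factorial ab.2 : ℝ))
        else 0)
      = 2 * (∑' n : ℕ, s ^ n * (x - s) ^ n /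
              ((Nat.factorial n : ℝ) * (Nat.factorial n : ℝ))) +
        x * (∑' n : ℕ, s ^ n * (x - s) ^ n /
              ((Nat.factorial n : ℝ) * (Nat.factorial (n + 1) : ℝ)))) ∧
    (2 * (∑' n : ℕ, s ^ n * (x - s) ^ n /
            ((Nat.factorial n : ℝ) * (Nat.factorial n : ℝ))) +
      x * (∑' n : ℕ, s ^ n * (x - s) ^ n /
            ((Nat.factorial n : ℝ) * (Nat.factorial (n + 1) : ℝ)))
      = ∑' n : ℕ, (x + 2 * n + 2) * s ^ n * (x - s) ^ n /
          ((Nat.factorial n : ℝ) * (Nat.factorial (n + 1) : ℝ))) ∧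
    (∑' n : ℕ, (x + 2 * n + 2) * s ^ n * (x - s) ^ n /
        ((Nat.factorial n : ℝ) * (Nat.factorial (n + 1) : ℝ)))
      = contBinom x s := by
  refine ⟨?_, cb_ii_iii x s, rfl⟩
  rw [add_assoc, cb_even, cb_odd]
end

section
/- The function F(x,s) = {x brace s} (defined by its everywhere-convergent series for all real x, s) satisfies the hyperbolic partial differential equation (∂²/∂x² + ∂²/∂x∂s) F(x,s) = F(x,s); that is, for all real x and s, ∂²F/∂x²(x,s) + ∂/∂x(∂F/∂s)(x,s) = F(x,s). -/
/-- Bessel-type series `∑ z^n / (n! (n+k)!)`. -/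
noncomputable def gB (k : ℕ) (z : ℝ) : ℝ :=
  ∑' n : ℕ, z ^ n / ((Nat.factorial n : ℝ) * (Nat.factorial (n + k) : ℝ))

theorem gB_summable (k : ℕ) (z : ℝ) :
    Summable (fun n : ℕ => z ^ n / ((Nat.factorial n : ℝ) * (Nat.factorial (n + k) : ℝ))) := by
  refine Summable.of_norm_bounded (Real.summable_pow_div_factorial |z|) (fun n => ?_)
  rw [norm_div, norm_pow, Real.norm_eq_abs, Real.norm_eq_abs]
  have h1 : (1 : ℝ) ≤ (Nat.factorial (n + k) : ℝ) := by
    exact_mod_cast Nat.succ_le_of_lt (Nat.factorial_pos _)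
  have h2 : (0 : ℝ) < (Nat.factorial n : ℝ) := by exact_mod_cast Nat.factorial_pos _
  rw [abs_of_nonneg (by positivity :
    (0 : ℝ) ≤ (Nat.factorial n : ℝ) * (Nat.factorial (n + k) : ℝ))]
  apply div_le_div_of_nonneg_left (by positivity) h2
  nlinarith

theorem gB_shift (k n : ℕ) (z : ℝ) :
    ((n + 1 : ℕ) : ℝ) * z ^ (n + 1 - 1) /
      ((Nat.factorial (n + 1) : ℝ) * (Nat.factorial (n + 1 + k) : ℝ)) =
    z ^ n / ((Nat.factorial n : ℝ) * (Nat.factorial (n + (k + 1)) : ℝ)) := by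
  have e : n + 1 + k = n + (k + 1) := by ring
  rw [e, Nat.factorial_succ n, Nat.add_sub_cancel]
  have h1 : (Nat.factorial (n + (k + 1)) : ℝ) ≠ 0 := by positivity
  have h2 : (Nat.factorial n : ℝ) ≠ 0 := by positivity
  push_cast
  field_simp

theorem gB_sumD (k : ℕ) (z : ℝ) :
    Summable (fun n : ℕ => (n : ℝ) * z ^ (n - 1) /
      ((Nat.factorial n : ℝ) * (Nat.factorial (n + k) : ℝ))) := by
  rw [← summable_nat_add_iff 1]
  simp only [gB_shift]
  exact gB_summable (k + 1) z

theorem gB_tsumD (k : ℕ) (z : ℝ) :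
    ∑' n : ℕ, (n : ℝ) * z ^ (n - 1) /
      ((Nat.factorial n : ℝ) * (Nat.factorial (n + k) : ℝ)) = gB (k + 1) z := by
  rw [(gB_sumD k z).tsum_eq_zero_add]
  simp only [gB_shift]
  simp [gB]

theorem gB_hasDerivAt (k : ℕ) (z : ℝ) : HasDerivAt (gB k) (gB (k + 1) z) z := by
  rw [← gB_tsumD]
  have hz : z ∈ Metric.ball (0 : ℝ) (|z| + 1) := by simp
  unfold gB
  refine hasDerivAt_tsum_of_isPreconnected
    (g := fun (n : ℕ) (y : ℝ) =>
      y ^ n / ((Nat.factorial n : ℝ) * (Nat.factorial (n + k) : ℝ)))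
    (g' := fun (n : ℕ) (y : ℝ) => (n : ℝ) * y ^ (n - 1) /
      ((Nat.factorial n : ℝ) * (Nat.factorial (n + k) : ℝ)))
    (gB_sumD k (|z| + 1)) Metric.isOpen_ball
    (convex_ball (0 : ℝ) (|z| + 1)).isPreconnected ?_ ?_ hz (gB_summable k z) hz
  · intro n y _
    exact (hasDerivAt_pow n y).div_const _
  · intro n y hy
    have hy' : |y| ≤ |z| + 1 := by
      have := Metric.mem_ball.1 hy
      rw [Real.dist_eq, sub_zero] at this
      exact this.le
    rw [norm_div, norm_mul, norm_pow, Real.norm_eq_abs, Real.norm_eq_abs, Real.norm_eq_abs,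
      abs_of_nonneg (by positivity : (0 : ℝ) ≤ (n : ℝ)),
      abs_of_nonneg (by positivity :
        (0 : ℝ) ≤ (Nat.factorial n : ℝ) * (Nat.factorial (n + k) : ℝ))]
    gcongr

theorem gB_mul (k n : ℕ) (z : ℝ) :
    z * ((n : ℝ) * z ^ (n - 1) / ((Nat.factorial n : ℝ) * (Nat.factorial (n + k) : ℝ))) =
    (n : ℝ) * (z ^ n / ((Nat.factorial n : ℝ) * (Nat.factorial (n + k) : ℝ))) := by
  cases n with
  | zero => simp
  | succ m => rw [Nat.add_sub_cancel, pow_succ]; ring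

theorem gB_rec (k : ℕ) (z : ℝ) : z * gB (k + 2) z + (k + 1) * gB (k + 1) z = gB k z := by
  rw [← gB_tsumD (k + 1) z]
  unfold gB
  rw [← tsum_mul_left, ← tsum_mul_left,
    ← ((gB_sumD (k + 1) z).mul_left z).tsum_add ((gB_summable (k + 1) z).mul_left _)]
  refine tsum_congr (fun n => ?_)
  rw [gB_mul, ← add_assoc n k 1, Nat.factorial_succ (n + k)]
  have h1 : (Nat.factorial (n + k) : ℝ) ≠ 0 := by positivity
  have h2 : (Nat.factorial n : ℝ) ≠ 0 := by positivity
  have h3 : (n : ℝ) + k + 1 ≠ 0 := by positivity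
  push_cast
  field_simp
  ring

theorem contBinom_eq (x s : ℝ) :
    contBinom x s = x * gB 1 (s * (x - s)) + 2 * gB 0 (s * (x - s)) := by
  rw [← gB_rec 0]
  have h : contBinom x s = (x + 2) * gB 1 (s * (x - s)) +
      2 * ((s * (x - s)) * gB 2 (s * (x - s))) := by
    rw [← gB_tsumD 1]
    unfold gB contBinom
    rw [← tsum_mul_left, ← tsum_mul_left, ← tsum_mul_left,
      ← ((gB_summable 1 _).mul_left _).tsum_add (((gB_sumD 1 _).mul_left _).mul_left _)]
    refine tsum_congr (fun n => ?_)
    rw [gB_mul, mul_pow]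
    ring
  rw [h]
  push_cast
  ring_nf

theorem gB_dx (k : ℕ) (s u : ℝ) :
    HasDerivAt (fun w : ℝ => gB k (s * (w - s))) (gB (k + 1) (s * (u - s)) * s) u := by
  have h : HasDerivAt (fun w : ℝ => s * (w - s)) s u := by
    simpa using ((hasDerivAt_id u).sub_const s).const_mul s
  exact (gB_hasDerivAt k (s * (u - s))).comp u h

theorem gB_ds (k : ℕ) (u s : ℝ) :
    HasDerivAt (fun w : ℝ => gB k (w * (u - w))) (gB (k + 1) (s * (u - s)) * (u - 2 * s)) s := by
  have h : HasDerivAt (fun w : ℝ => w * (u - w)) (u - 2 * s) s := by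
    have := (hasDerivAt_id s).mul ((hasDerivAt_id s).const_sub u)
    refine this.congr_deriv ?_
    simp
    ring
  exact (gB_hasDerivAt k (s * (u - s))).comp s h

/-- the continuous binomial coefficient, viewed as a function
`F(x,s) = {x brace s}` of two real variables, satisfies the hyperbolic PDE
`(∂²/∂x² + ∂²/∂x∂s) F = F`. -/
theorem contBinom_pde (x s : ℝ) :
    deriv (fun u : ℝ => deriv (fun w : ℝ => contBinom w s) u) x +
      deriv (fun u : ℝ => deriv (fun w : ℝ => contBinom u w) s) x =
    contBinom x s := by
  simp only [contBinom_eq]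
  have e1 : (fun u : ℝ => deriv (fun w : ℝ => w * gB 1 (s * (w - s)) +
      2 * gB 0 (s * (w - s))) u) = fun u : ℝ => (1 * gB 1 (s * (u - s)) +
        u * (gB 2 (s * (u - s)) * s)) + 2 * (gB 1 (s * (u - s)) * s) := by
    funext u
    exact (((hasDerivAt_id u).mul (gB_dx 1 s u)).add ((gB_dx 0 s u).const_mul 2)).deriv
  have e2 : (fun u : ℝ => deriv (fun w : ℝ => u * gB 1 (w * (u - w)) +
      2 * gB 0 (w * (u - w))) s) = fun u : ℝ => (u - 2 * s) * (u * gB 2 (s * (u - s)) +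
        2 * gB 1 (s * (u - s))) := by
    funext u
    refine (((gB_ds 1 u s).const_mul u).add ((gB_ds 0 u s).const_mul 2)).deriv.trans ?_
    ring
  have d1 := (((gB_dx 1 s x).const_mul 1).add
    ((hasDerivAt_id x).mul ((gB_dx 2 s x).mul_const s))).add
    (((gB_dx 1 s x).mul_const s).const_mul 2)
  have d2 := ((hasDerivAt_id x).sub_const (2 * s)).mul
    (((hasDerivAt_id x).mul (gB_dx 2 s x)).add ((gB_dx 1 s x).const_mul 2))
  rw [e1, e2]
  refine (congrArg₂ (· + ·) d1.deriv d2.deriv).trans ?_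
  have r0 := gB_rec 0 (s * (x - s))
  have r1 := gB_rec 1 (s * (x - s))
  norm_num at r0 r1 ⊢
  linear_combination x * r1 + 2 * r0
end

section
/- For real numbers 0 < s < x, the continuous binomial coefficient is given in terms of the modified Bessel functions I_0 and I_1 by {x brace s} = 2·I_0(2·s^{1/2}(x−s)^{1/2}) + (x/(s^{1/2}(x−s)^{1/2}))·I_1(2·s^{1/2}(x−s)^{1/2}). -/
/-- The modified Bessel function `I₀`. -/
noncomputable def besselI0 (z : ℝ) : ℝ :=
  ∑' k : ℕ, (z ^ 2 / 4) ^ k / ((Nat.factorial k : ℝ) * (Nat.factorial k : ℝ))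

/-- The modified Bessel function `I₁`. -/
noncomputable def besselI1 (z : ℝ) : ℝ :=
  (z / 2) * ∑' k : ℕ, (z ^ 2 / 4) ^ k / ((Nat.factorial k : ℝ) * (Nat.factorial (k + 1) : ℝ))

theorem summable_aux0 (t : ℝ) (ht : 0 ≤ t) :
    Summable (fun k : ℕ => t ^ k / ((Nat.factorial k : ℝ) * (Nat.factorial k : ℝ))) := by
  refine Summable.of_nonneg_of_le (fun k => by positivity) (fun k => ?_)
    (Real.summable_pow_div_factorial t)
  have h1 : (1 : ℝ) ≤ (Nat.factorial k : ℝ) := by exact_mod_cast Nat.factorial_pos k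
  gcongr
  nlinarith

theorem summable_aux1 (t : ℝ) (ht : 0 ≤ t) :
    Summable (fun k : ℕ => t ^ k / ((Nat.factorial k : ℝ) * (Nat.factorial (k + 1) : ℝ))) := by
  refine Summable.of_nonneg_of_le (fun k => by positivity) (fun k => ?_)
    (Real.summable_pow_div_factorial t)
  have h1 : (1 : ℝ) ≤ (Nat.factorial (k + 1) : ℝ) := by exact_mod_cast Nat.factorial_pos (k + 1)
  have h2 : (0 : ℝ) < (Nat.factorial k : ℝ) := by positivity
  gcongr
  nlinarith

/-- Koornwinder's formula for the continuous binomial coefficient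
in terms of the modified Bessel functions `I₀` and `I₁`, for `0 < s < x`. -/
theorem contBinom_eq_bessel (x s : ℝ) (hs : 0 < s) (hsx : s < x) :
    contBinom x s =
      2 * besselI0 (2 * Real.sqrt s * Real.sqrt (x - s)) +
        (x / (Real.sqrt s * Real.sqrt (x - s))) *
          besselI1 (2 * Real.sqrt s * Real.sqrt (x - s)) := by
  have hu : 0 < x - s := sub_pos.mpr hsx
  have ha : 0 < Real.sqrt s := Real.sqrt_pos.mpr hs
  have hb : 0 < Real.sqrt (x - s) := Real.sqrt_pos.mpr hu
  have hz : (2 * Real.sqrt s * Real.sqrt (x - s)) ^ 2 / 4 = s * (x - s) := by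
    rw [mul_pow, mul_pow, Real.sq_sqrt hs.le, Real.sq_sqrt hu.le]; ring
  have ht : 0 ≤ s * (x - s) := by positivity
  unfold contBinom besselI0 besselI1
  rw [hz, ← mul_assoc]
  have hc : x / (Real.sqrt s * Real.sqrt (x - s)) * (2 * Real.sqrt s * Real.sqrt (x - s) / 2)
      = x := by
    field_simp
  rw [hc, ← tsum_mul_left, ← tsum_mul_left,
    ← ((summable_aux0 _ ht).mul_left 2).tsum_add ((summable_aux1 _ ht).mul_left x)]
  refine tsum_congr fun n => ?_
  have h2 : (Nat.factorial n : ℝ) ≠ 0 := by positivity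
  have h3 : (n : ℝ) + 1 ≠ 0 := by positivity
  rw [Nat.factorial_succ, mul_pow]
  push_cast
  field_simp
  ring
end

section
/- For every real x ≥ 0, ∫_0^x {x brace s} ds = 2(e^x − 1); consequently b_{1/2}(x) = ∫_0^x {x brace s}·(1/2)^s·(1/2)^{x−s} ds = (e^x − 1)·2^{1−x}. -/
theorem beta_aux (x : ℝ) (n : ℕ) : ∀ m : ℕ,
    (∫ s in (0 : ℝ)..x, s ^ m * (x - s) ^ n) =
      (Nat.factorial m : ℝ) * (Nat.factorial n : ℝ) / (Nat.factorial (m + n + 1) : ℝ)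
        * x ^ (m + n + 1) := by
  induction n with
  | zero =>
    intro m
    simp only [pow_zero, mul_one, integral_pow, Nat.factorial_zero, Nat.cast_one, add_zero,
      Nat.factorial_succ]
    have := Nat.factorial_ne_zero m
    push_cast
    field_simp
    simp
  | succ n ih =>
    intro m
    have h1 : ∀ s ∈ Set.uIcc 0 x, HasDerivAt (fun s : ℝ => s ^ (m + 1) * (x - s) ^ (n + 1))
        (((m : ℝ) + 1) * (s ^ m * (x - s) ^ (n + 1))
          - ((n : ℝ) + 1) * (s ^ (m + 1) * (x - s) ^ n)) s := by
      intro s _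
      have h := ((hasDerivAt_id s).pow (m + 1)).mul (((hasDerivAt_id s).const_sub x).pow (n + 1))
      refine HasDerivAt.congr_deriv h ?_
      simp
      ring
    have h2 := intervalIntegral.integral_eq_sub_of_hasDerivAt h1
      (Continuous.intervalIntegrable (by fun_prop) _ _)
    rw [intervalIntegral.integral_sub (Continuous.intervalIntegrable (by fun_prop) _ _)
      (Continuous.intervalIntegrable (by fun_prop) _ _),
      intervalIntegral.integral_const_mul, intervalIntegral.integral_const_mul, ih (m + 1)] at h2
    simp only [sub_self, ne_eq, Nat.add_eq_zero_iff, one_ne_zero, and_false, not_false_eq_true,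
      zero_pow, mul_zero, zero_mul] at h2
    have hm : (m : ℝ) + 1 ≠ 0 := by positivity
    have e : m + 1 + n + 1 = m + (n + 1) + 1 := by ring
    rw [e] at h2
    apply mul_left_cancel₀ hm
    rw [sub_eq_zero.1 h2, Nat.factorial_succ m, Nat.factorial_succ n]
    push_cast
    ring

theorem contBinom_int_one (x : ℝ) (hx : 0 ≤ x) :
    (∫ s in (0 : ℝ)..x, contBinom x s) = 2 * (Real.exp x - 1) := by
  have hb : ∀ n : ℕ, ∀ s ∈ Set.uIoc 0 x,
      ‖(x + 2 * n + 2) * s ^ n * (x - s) ^ n /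
        ((Nat.factorial n : ℝ) * (Nat.factorial (n + 1) : ℝ))‖
        ≤ (x + 2) * ((x ^ 2) ^ n / (Nat.factorial n : ℝ)) := by
    intro n s hs
    rw [Set.uIoc_of_le hx] at hs
    have hs0 : 0 ≤ s := hs.1.le
    have hs1 : 0 ≤ x - s := sub_nonneg.2 hs.2
    rw [Real.norm_of_nonneg (by positivity)]
    have hp : s ^ n * (x - s) ^ n ≤ (x ^ 2) ^ n := by
      rw [← mul_pow]
      apply pow_le_pow_left₀ (by positivity)
      nlinarith [hs.2]
    have hf : (n : ℝ) + 1 ≤ (Nat.factorial (n + 1) : ℝ) := by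
      exact_mod_cast Nat.self_le_factorial (n + 1)
    have hc : x + 2 * n + 2 ≤ (x + 2) * (Nat.factorial (n + 1) : ℝ) := by
      have : (0 : ℝ) ≤ n := by positivity
      nlinarith [mul_nonneg hx this]
    have p1 : (0 : ℝ) < Nat.factorial n := by exact_mod_cast Nat.factorial_pos n
    have p2 : (0 : ℝ) < Nat.factorial (n + 1) := by exact_mod_cast Nat.factorial_pos (n + 1)
    rw [div_le_iff₀ (by positivity)]
    have : (x + 2) * ((x ^ 2) ^ n / (Nat.factorial n : ℝ)) *
        ((Nat.factorial n : ℝ) * (Nat.factorial (n + 1) : ℝ))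
        = ((x + 2) * (Nat.factorial (n + 1) : ℝ)) * (x ^ 2) ^ n := by
      field_simp
    rw [this, mul_assoc]
    exact mul_le_mul hc hp (by positivity) (by positivity)
  have hsum : Summable fun n : ℕ => (x + 2) * ((x ^ 2) ^ n / (Nat.factorial n : ℝ)) :=
    (Real.summable_pow_div_factorial (x ^ 2)).mul_left _
  have key := intervalIntegral.hasSum_integral_of_dominated_convergence
    (μ := MeasureTheory.volume) (a := 0) (b := x)
    (F := fun (n : ℕ) (s : ℝ) => (x + 2 * n + 2) * s ^ n * (x - s) ^ n /
        ((Nat.factorial n : ℝ) * (Nat.factorial (n + 1) : ℝ)))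
    (f := contBinom x)
    (fun n _ => (x + 2) * ((x ^ 2) ^ n / (Nat.factorial n : ℝ)))
    (fun n => Continuous.aestronglyMeasurable (by fun_prop))
    (fun n => Filter.Eventually.of_forall (hb n))
    (Filter.Eventually.of_forall fun _ _ => hsum)
    (by simp)
    (Filter.Eventually.of_forall fun s hs =>
      (Summable.of_norm_bounded hsum (fun n => hb n s hs)).hasSum)
  have hc := (hasSum_nat_add_iff' 1).2 (Real.hasSum_cosh x)
  have h2 := (hc.add (Real.hasSum_sinh x)).mul_left 2
  have e : (fun n : ℕ => ∫ s in (0 : ℝ)..x, (x + 2 * n + 2) * s ^ n * (x - s) ^ n /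
        ((Nat.factorial n : ℝ) * (Nat.factorial (n + 1) : ℝ))) =
      fun n : ℕ => 2 * (x ^ (2 * (n + 1)) / (Nat.factorial (2 * (n + 1)) : ℝ)
        + x ^ (2 * n + 1) / (Nat.factorial (2 * n + 1) : ℝ)) := by
    funext n
    have : ∀ s : ℝ, (x + 2 * n + 2) * s ^ n * (x - s) ^ n /
        ((Nat.factorial n : ℝ) * (Nat.factorial (n + 1) : ℝ)) =
        (x + 2 * n + 2) / ((Nat.factorial n : ℝ) * (Nat.factorial (n + 1) : ℝ)) *
          (s ^ n * (x - s) ^ n) := by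
      intro s
      ring
    simp only [this]
    rw [intervalIntegral.integral_const_mul, beta_aux, ← two_mul,
      show 2 * (n + 1) = (2 * n + 1) + 1 by ring, Nat.factorial_succ (2 * n + 1),
      Nat.factorial_succ n]
    have p1 : (Nat.factorial n : ℝ) ≠ 0 := by exact_mod_cast Nat.factorial_ne_zero n
    have p2 : (Nat.factorial (2 * n + 1) : ℝ) ≠ 0 := by
      exact_mod_cast Nat.factorial_ne_zero (2 * n + 1)
    have p3 : (n : ℝ) + 1 ≠ 0 := by positivity
    have p4 : (2 * n : ℝ) + 1 + 1 ≠ 0 := by positivity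
    push_cast
    field_simp
    ring
  rw [e] at key
  rw [key.unique h2]
  have h3 := Real.cosh_add_sinh x
  simp
  linarith

/-- `∫₀ˣ {x brace s} ds = 2(eˣ − 1)`, and consequently
`b_{1/2}(x) = ∫₀ˣ {x brace s} (1/2)ˢ (1/2)^{x−s} ds = (eˣ − 1)·2^{1−x}`. -/
theorem contBinom_integral (x : ℝ) (hx : 0 ≤ x) :
    (∫ s in (0 : ℝ)..x, contBinom x s) = 2 * (Real.exp x - 1) ∧
    (∫ s in (0 : ℝ)..x,
        contBinom x s * ((1 : ℝ) / 2) ^ s * ((1 : ℝ) / 2) ^ (x - s)) =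
      (Real.exp x - 1) * (2 : ℝ) ^ (1 - x) := by
  refine ⟨contBinom_int_one x hx, ?_⟩
  have : ∀ s : ℝ, contBinom x s * ((1 : ℝ) / 2) ^ s * ((1 : ℝ) / 2) ^ (x - s)
      = contBinom x s * ((1 : ℝ) / 2) ^ x := by
    intro s
    rw [mul_assoc, ← Real.rpow_add (by norm_num)]
    congr 2
    ring
  simp only [this]
  rw [intervalIntegral.integral_mul_const, contBinom_int_one x hx,
    Real.rpow_sub (by norm_num), Real.rpow_one, Real.div_rpow (by norm_num) (by norm_num),
    Real.one_rpow]
  ring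
end

section
/- For 0 < p < 1 and x ≥ 0, the normalization constant b_p(x) is given by the absolutely convergent double series b_p(x) = 2(1−p)^x · ∑_{k=0}^∞ ∑_{n=0}^∞ (ln(p/(1−p)))^k · C(n+k, k) · [ x^{2n+k+1}/(2n+k+1)! + x^{2n+k+2}/((2n+2)·(2n+k+1)!) ]. -/
/-- The normalization constant `b_p(x) = ∫₀ˣ {x brace s} pˢ (1−p)^{x−s} ds`. -/
noncomputable def bConst (p x : ℝ) : ℝ :=
  ∫ s in (0 : ℝ)..x, contBinom x s * p ^ s * (1 - p) ^ (x - s)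

theorem aux_beta (x : ℝ) (b : ℕ) : ∀ a : ℕ, ∫ s in (0 : ℝ)..x, s ^ a * (x - s) ^ b =
    (Nat.factorial a : ℝ) * (Nat.factorial b : ℝ) / (Nat.factorial (a + b + 1) : ℝ) *
      x ^ (a + b + 1) := by
  induction b with
  | zero =>
    intro a
    simp only [pow_zero, mul_one, integral_pow, Nat.factorial_zero, Nat.cast_one, add_zero]
    rw [Nat.factorial_succ]
    have := Nat.factorial_pos a
    push_cast
    field_simp
    simp
  | succ b ih =>
    intro a
    have hv : ∀ s ∈ Set.uIcc (0 : ℝ) x,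
        HasDerivAt (fun s : ℝ => s ^ (a + 1) / ((a : ℝ) + 1)) (s ^ a) s := by
      intro s _
      have h := (hasDerivAt_pow (a + 1) s).div_const ((a : ℝ) + 1)
      refine h.congr_deriv ?_
      have : (a : ℝ) + 1 ≠ 0 := by positivity
      rw [Nat.add_sub_cancel, Nat.cast_add, Nat.cast_one]
      exact mul_div_cancel_left₀ _ this
    have hu : ∀ s ∈ Set.uIcc (0 : ℝ) x,
        HasDerivAt (fun s : ℝ => (x - s) ^ (b + 1)) (-(((b : ℝ) + 1) * (x - s) ^ b)) s := by
      intro s _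
      have h := ((hasDerivAt_id s).const_sub x).pow (b + 1)
      refine h.congr_deriv ?_
      rw [Nat.add_sub_cancel, Nat.cast_add, Nat.cast_one]
      simp
    have h := intervalIntegral.integral_mul_deriv_eq_deriv_mul hu hv
      (Continuous.intervalIntegrable (by fun_prop) _ _)
      (Continuous.intervalIntegrable (by fun_prop) _ _)
    have e1 : ∀ s : ℝ, s ^ a * (x - s) ^ (b + 1) = (x - s) ^ (b + 1) * s ^ a :=
      fun s => mul_comm _ _
    have e2 : ∀ s : ℝ, -(((b : ℝ) + 1) * (x - s) ^ b) * (s ^ (a + 1) / ((a : ℝ) + 1)) =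
        (-(((b : ℝ) + 1) / ((a : ℝ) + 1))) * (s ^ (a + 1) * (x - s) ^ b) := by
      intro s; ring
    simp only [e1]
    rw [h]
    simp only [e2]
    rw [intervalIntegral.integral_const_mul, ih (a + 1)]
    have e3 : a + 1 + b + 1 = a + (b + 1) + 1 := by ring
    rw [e3, Nat.factorial_succ a, Nat.factorial_succ b]
    have h1 : (a : ℝ) + 1 ≠ 0 := by positivity
    have h2 : ((a + (b + 1) + 1).factorial : ℝ) ≠ 0 := by positivity
    push_cast
    simp
    field_simp

theorem aux_bound (x : ℝ) (hx : 0 ≤ x) (n : ℕ) (s : ℝ) (hs : s ∈ Set.Icc 0 x) :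
    ‖(x + 2 * n + 2) * s ^ n * (x - s) ^ n /
      ((Nat.factorial n : ℝ) * (Nat.factorial (n + 1) : ℝ))‖ ≤
    (x + 2) * ((x * x) ^ n / (Nat.factorial n : ℝ)) := by
  obtain ⟨h0, h1⟩ := hs
  have h2 : 0 ≤ x - s := by linarith
  rw [Real.norm_of_nonneg (by positivity)]
  have hA : (x + 2 * n + 2) / (Nat.factorial (n + 1) : ℝ) ≤ x + 2 := by
    rw [div_le_iff₀ (by positivity)]
    have : ((n : ℝ) + 1) ≤ (Nat.factorial (n + 1) : ℝ) := by
      exact_mod_cast Nat.self_le_factorial (n + 1)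
    have h3 : (0 : ℝ) ≤ n := by positivity
    nlinarith [mul_nonneg hx h3]
  have hB : s ^ n * (x - s) ^ n ≤ (x * x) ^ n := by
    rw [← mul_pow]
    apply pow_le_pow_left₀ (by positivity)
    apply mul_le_mul h1 (by linarith) h2 hx
  calc _ = ((x + 2 * n + 2) / (Nat.factorial (n + 1) : ℝ)) *
        ((s ^ n * (x - s) ^ n) / (Nat.factorial n : ℝ)) := by
        field_simp
    _ ≤ _ := by gcongr

/-- for `0 < p < 1` and `x ≥ 0`, the normalization constant `b_p(x)`
is given by an absolutely convergent double series. -/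
theorem bConst_series (p x : ℝ) (hp0 : 0 < p) (hp1 : p < 1) (hx : 0 ≤ x) :
    Summable (fun kn : ℕ × ℕ =>
      (Real.log (p / (1 - p))) ^ kn.1 * (Nat.choose (kn.2 + kn.1) kn.1 : ℝ) *
        (x ^ (2 * kn.2 + kn.1 + 1) / (Nat.factorial (2 * kn.2 + kn.1 + 1) : ℝ) +
          x ^ (2 * kn.2 + kn.1 + 2) /
            ((2 * kn.2 + 2 : ℝ) * (Nat.factorial (2 * kn.2 + kn.1 + 1) : ℝ)))) ∧
    bConst p x =
      2 * (1 - p) ^ x *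
        ∑' kn : ℕ × ℕ,
          (Real.log (p / (1 - p))) ^ kn.1 * (Nat.choose (kn.2 + kn.1) kn.1 : ℝ) *
            (x ^ (2 * kn.2 + kn.1 + 1) / (Nat.factorial (2 * kn.2 + kn.1 + 1) : ℝ) +
              x ^ (2 * kn.2 + kn.1 + 2) /
                ((2 * kn.2 + 2 : ℝ) * (Nat.factorial (2 * kn.2 + kn.1 + 1) : ℝ))) := by
  set L := Real.log (p / (1 - p)) with hL
  have hq : 0 < 1 - p := by linarith
  let A : ℕ → ℝ → ℝ := fun n s => (x + 2 * n + 2) * s ^ n * (x - s) ^ n /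
    ((Nat.factorial n : ℝ) * (Nat.factorial (n + 1) : ℝ))
  let E : ℕ → ℝ → ℝ := fun k s => (L * s) ^ k / (Nat.factorial k : ℝ)
  let f : ℕ × ℕ → C(ℝ, ℝ) := fun kn => ⟨fun s => E kn.1 s * A kn.2 s, by
    simp only [E, A]; fun_prop⟩
  have hEb : ∀ k s, s ∈ Set.Icc 0 x → ‖E k s‖ ≤ (|L| * x) ^ k / (Nat.factorial k : ℝ) := by
    intro k s hs
    simp only [E, norm_div, norm_pow, norm_mul, Real.norm_eq_abs, Nat.abs_cast]
    rw [abs_of_nonneg hs.1]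
    have := hs.1
    have := hs.2
    gcongr
  have hAb : ∀ n s, s ∈ Set.Icc 0 x → ‖A n s‖ ≤ (x + 2) * ((x * x) ^ n / (Nat.factorial n : ℝ)) :=
    fun n s hs => aux_bound x hx n s hs
  have sE : Summable (fun k : ℕ => (|L| * x) ^ k / (Nat.factorial k : ℝ)) :=
    Real.summable_pow_div_factorial _
  have sA : Summable (fun n : ℕ => (x + 2) * ((x * x) ^ n / (Nat.factorial n : ℝ))) :=
    (Real.summable_pow_div_factorial _).mul_left _
  have sP := sE.mul_of_nonneg sA (fun k => by positivity) (fun n => by positivity)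
  have hf : Summable fun i : ℕ × ℕ =>
      ‖(f i).restrict (⟨Set.uIcc 0 x, isCompact_uIcc⟩ : TopologicalSpace.Compacts ℝ)‖ := by
    refine Summable.of_nonneg_of_le (fun _ => norm_nonneg _) (fun i => ?_) sP
    rw [ContinuousMap.norm_le _ (by positivity)]
    rintro ⟨s, hs⟩
    have hs' : s ∈ Set.Icc 0 x := by
      have : s ∈ Set.uIcc 0 x := hs
      rwa [Set.uIcc_of_le hx] at this
    change ‖E i.1 s * A i.2 s‖ ≤ _
    rw [norm_mul]
    exact mul_le_mul (hEb _ _ hs') (hAb _ _ hs') (norm_nonneg _) (by positivity)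
  have key := intervalIntegral.hasSum_intervalIntegral_of_summable_norm (a := 0) (b := x) hf
  have hterm : ∀ i : ℕ × ℕ, ∫ s in (0 : ℝ)..x, f i s = 2 * (L ^ i.1 *
      (Nat.choose (i.2 + i.1) i.1 : ℝ) *
        (x ^ (2 * i.2 + i.1 + 1) / (Nat.factorial (2 * i.2 + i.1 + 1) : ℝ) +
          x ^ (2 * i.2 + i.1 + 2) /
            ((2 * i.2 + 2 : ℝ) * (Nat.factorial (2 * i.2 + i.1 + 1) : ℝ)))) := by
    rintro ⟨k, n⟩
    have e : ∀ s : ℝ, f (k, n) s = (L ^ k / (Nat.factorial k : ℝ) * (x + 2 * n + 2) /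
        ((Nat.factorial n : ℝ) * (Nat.factorial (n + 1) : ℝ))) * (s ^ (n + k) * (x - s) ^ n) := by
      intro s
      simp only [f, E, A, ContinuousMap.coe_mk]
      rw [mul_pow, pow_add]
      ring
    simp only [e]
    rw [intervalIntegral.integral_const_mul, aux_beta]
    have hc : (Nat.choose (n + k) k : ℝ) =
        (Nat.factorial (n + k) : ℝ) / ((Nat.factorial n : ℝ) * (Nat.factorial k : ℝ)) := by
      rw [eq_div_iff (by positivity), ← Nat.add_choose_mul_factorial_mul_factorial n k]
      push_cast
      ring
    rw [hc, show n + k + n + 1 = 2 * n + k + 1 by ring, Nat.factorial_succ n]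
    have h1 : (n : ℝ) + 1 ≠ 0 := by positivity
    have h3 : (2 * n : ℝ) + 2 ≠ 0 := by positivity
    rw [show (2 * n : ℝ) + 2 = 2 * (n + 1) by ring]
    push_cast
    rw [show 2 * n + k + 2 = (2 * n + k + 1) + 1 by ring, pow_succ x (2 * n + k + 1)]
    field_simp
    ring
  simp only [hterm] at key
  have hsum := (summable_mul_left_iff (two_ne_zero (α := ℝ))).1 key.summable
  refine ⟨hsum, ?_⟩
  have hI : bConst p x = (1 - p) ^ x * ∫ s in (0 : ℝ)..x, ∑' i, f i s := by
    unfold bConst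
    rw [← intervalIntegral.integral_const_mul]
    apply intervalIntegral.integral_congr
    intro s hs
    rw [Set.uIcc_of_le hx] at hs
    have nE : Summable fun k => ‖E k s‖ :=
      Summable.of_nonneg_of_le (fun _ => norm_nonneg _) (fun k => hEb k s hs) sE
    have nA : Summable fun n => ‖A n s‖ :=
      Summable.of_nonneg_of_le (fun _ => norm_nonneg _) (fun n => hAb n s hs) sA
    have h1 : ∑' i, f i s = Real.exp (L * s) * contBinom x s := by
      have := tsum_mul_tsum_of_summable_norm nE nA
      change ∑' i : ℕ × ℕ, E i.1 s * A i.2 s = _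
      rw [← this, Real.exp_eq_exp_ℝ, ← (NormedSpace.expSeries_div_hasSum_exp (L * s)).tsum_eq]
      rfl
    have h2 : p ^ s * (1 - p) ^ (x - s) = (1 - p) ^ x * Real.exp (L * s) := by
      rw [Real.rpow_def_of_pos hp0, Real.rpow_def_of_pos hq, Real.rpow_def_of_pos hq,
        ← Real.exp_add, ← Real.exp_add, hL, Real.log_div hp0.ne' hq.ne']
      congr 1
      ring
    change contBinom x s * p ^ s * (1 - p) ^ (x - s) = (1 - p) ^ x * ∑' i, f i s
    rw [h1, mul_assoc, h2]
    ring
  rw [hI, ← key.tsum_eq, tsum_mul_left]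
  ring
end

section
/- For every integer l ≥ 1, every 0 < p < 1, and every real x ≥ 0, ∫_0^x s^l·{x brace s}·p^s·(1−p)^{x−s} ds = 2(1−p)^x · ∑_{k=0}^∞ ∑_{n=0}^∞ (ln(p/(1−p)))^k · C(n+k+l, n) · (k+l)_l · [ x^{2n+k+l+1}/(2n+k+l+1)! + x^{2n+k+l+2}/((2n+2)·(2n+k+l+1)!) ], where (a)_m denotes the falling factorial a(a−1)⋯(a−m+1). -/
lemma cb_beta (x : ℝ) (n : ℕ) : ∀ a : ℕ, ∫ s in (0 : ℝ)..x, s ^ a * (x - s) ^ n =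
    (Nat.factorial a : ℝ) * (Nat.factorial n : ℝ) / (Nat.factorial (a + n + 1) : ℝ) *
      x ^ (a + n + 1) := by
  induction n with
  | zero =>
    intro a
    have h : (Nat.factorial a : ℝ) ≠ 0 := by positivity
    have h1 : (a : ℝ) + 1 ≠ 0 := by positivity
    simp [Nat.factorial_succ]
    field_simp
  | succ n ih =>
    intro a
    have hd : ∀ s ∈ Set.uIcc 0 x, HasDerivAt (fun s : ℝ => s ^ (a + 1) * (x - s) ^ (n + 1))
        (((a : ℝ) + 1) * (s ^ a * (x - s) ^ (n + 1))
          - ((n : ℝ) + 1) * (s ^ (a + 1) * (x - s) ^ n)) s := by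
      intro s _
      have h1 := hasDerivAt_pow (a + 1) s
      have h2 : HasDerivAt (fun s : ℝ => (x - s) ^ (n + 1))
          (((n + 1 : ℕ) : ℝ) * (x - s) ^ n * (-1)) s := by
        simpa using ((hasDerivAt_id' s).const_sub x).fun_pow (n + 1)
      refine (h1.mul h2).congr_deriv ?_
      rw [Nat.add_sub_cancel]
      push_cast
      ring
    have hi := intervalIntegral.integral_eq_sub_of_hasDerivAt hd
      (Continuous.intervalIntegrable (by fun_prop) _ _)
    rw [intervalIntegral.integral_sub (Continuous.intervalIntegrable (by fun_prop) _ _)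
      (Continuous.intervalIntegrable (by fun_prop) _ _),
      intervalIntegral.integral_const_mul, intervalIntegral.integral_const_mul, ih (a + 1)] at hi
    simp only [sub_self, ne_eq, Nat.add_eq_zero_iff, one_ne_zero, and_false, not_false_eq_true,
      zero_pow, mul_zero, zero_mul] at hi
    have e : a + 1 + n + 1 = a + (n + 1) + 1 := by ring
    rw [e] at hi
    have h1 : (a : ℝ) + 1 ≠ 0 := by positivity
    apply mul_left_cancel₀ h1
    rw [sub_eq_zero.mp hi, Nat.factorial_succ a, Nat.factorial_succ n]
    push_cast
    ring

lemma cb_mul (f g : ℕ → ℝ) (a b : ℝ) (hf : HasSum f a) (hg : HasSum g b)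
    (hfn : Summable fun n => ‖f n‖) (hgn : Summable fun n => ‖g n‖) :
    HasSum (fun kn : ℕ × ℕ => f kn.1 * g kn.2) (a * b) := by
  have h : Summable (fun kn : ℕ × ℕ => f kn.1 * g kn.2) := summable_mul_of_summable_norm hfn hgn
  exact hf.mul hg h

lemma cb_bound (x s : ℝ) (h0 : 0 ≤ s) (h1 : s ≤ x) (n : ℕ) :
    ‖(x + 2 * n + 2) * s ^ n * (x - s) ^ n /
    ((Nat.factorial n : ℝ) * (Nat.factorial (n + 1) : ℝ))‖ ≤
      (x + 2) * ((x * x) ^ n / (Nat.factorial n : ℝ)) := by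
  have hx : 0 ≤ x := h0.trans h1
  have hxs : 0 ≤ x - s := sub_nonneg.mpr h1
  have hf : (1 : ℝ) ≤ (Nat.factorial n : ℝ) := by exact_mod_cast Nat.factorial_pos n
  rw [Real.norm_of_nonneg (by positivity)]
  have e1 : (x + 2 * n + 2) ≤ (x + 2) * ((n : ℝ) + 1) := by
    have : 0 ≤ x * (n : ℝ) := by positivity
    nlinarith
  have e2 : s ^ n * (x - s) ^ n ≤ (x * x) ^ n := by
    rw [← mul_pow]
    have : x - s ≤ x := by linarith
    gcongr
  rw [Nat.factorial_succ]
  push_cast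
  rw [div_le_iff₀ (by positivity)]
  have hq : (x + 2) * ((x * x) ^ n / (Nat.factorial n : ℝ)) *
      ((Nat.factorial n : ℝ) * (((n : ℝ) + 1) * (Nat.factorial n : ℝ)))
      = ((x + 2) * ((n : ℝ) + 1)) * (x * x) ^ n * (Nat.factorial n : ℝ) := by
    field_simp
  rw [hq]
  calc (x + 2 * n + 2) * s ^ n * (x - s) ^ n
      = (x + 2 * n + 2) * (s ^ n * (x - s) ^ n) := by ring
    _ ≤ ((x + 2) * ((n : ℝ) + 1)) * (x * x) ^ n := by gcongr
    _ ≤ _ := le_mul_of_one_le_right (by positivity) hf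

/-- weighted moment integrals of the continuous binomial coefficients,
for `l ≥ 1`, `0 < p < 1`, `x ≥ 0`; here `Nat.descFactorial a m` is the falling
factorial `(a)_m = a(a−1)⋯(a−m+1)`. -/
theorem contBinom_weighted_moment_integral (l : ℕ) (hl : 1 ≤ l)
    (p x : ℝ) (hp0 : 0 < p) (hp1 : p < 1) (hx : 0 ≤ x) :
    (∫ s in (0 : ℝ)..x, s ^ l * contBinom x s * p ^ s * (1 - p) ^ (x - s)) =
      2 * (1 - p) ^ x *
        ∑' kn : ℕ × ℕ,
          (Real.log (p / (1 - p))) ^ kn.1 *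
            (Nat.choose (kn.2 + kn.1 + l) kn.2 : ℝ) *
            (Nat.descFactorial (kn.1 + l) l : ℝ) *
            (x ^ (2 * kn.2 + kn.1 + l + 1) /
                (Nat.factorial (2 * kn.2 + kn.1 + l + 1) : ℝ) +
              x ^ (2 * kn.2 + kn.1 + l + 2) /
                ((2 * kn.2 + 2 : ℝ) *
                  (Nat.factorial (2 * kn.2 + kn.1 + l + 1) : ℝ))) := by
  have hq0 : 0 < 1 - p := by linarith
  set L := Real.log (p / (1 - p)) with hL
  let F : ℕ × ℕ → ℝ → ℝ := fun kn s =>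
    (1 - p) ^ x * s ^ l * ((L * s) ^ kn.1 / (Nat.factorial kn.1 : ℝ) *
      ((x + 2 * kn.2 + 2) * s ^ kn.2 * (x - s) ^ kn.2 /
    ((Nat.factorial kn.2 : ℝ) * (Nat.factorial (kn.2 + 1) : ℝ))))
  let B : ℕ × ℕ → ℝ := fun kn =>
    (1 - p) ^ x * x ^ l * ((|L| * x) ^ kn.1 / (Nat.factorial kn.1 : ℝ) *
      ((x + 2) * ((x * x) ^ kn.2 / (Nat.factorial kn.2 : ℝ))))
  have hB : Summable B := by
    apply Summable.mul_left
    exact Summable.mul_of_nonneg (Real.summable_pow_div_factorial (|L| * x))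
      ((Real.summable_pow_div_factorial (x * x)).mul_left (x + 2))
      (fun k => by positivity) (fun k => by positivity)
  have key : HasSum (fun kn => ∫ s in (0 : ℝ)..x, F kn s)
      (∫ s in (0 : ℝ)..x, s ^ l * contBinom x s * p ^ s * (1 - p) ^ (x - s)) := by
    apply intervalIntegral.hasSum_integral_of_dominated_convergence (fun kn _ => B kn)
    · intro kn
      exact (Continuous.aestronglyMeasurable (by fun_prop))
    · intro kn
      refine Filter.Eventually.of_forall fun s hs => ?_
      rw [Set.uIoc_of_le hx] at hs
      obtain ⟨h0, h1⟩ := hs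
      have hb := cb_bound x s h0.le h1 kn.2
      simp only [F, B]
      rw [norm_mul, norm_mul ((L * s) ^ kn.1 / (Nat.factorial kn.1 : ℝ))]
      have hn1 : ‖(1 - p) ^ x * s ^ l‖ ≤ (1 - p) ^ x * x ^ l := by
        rw [Real.norm_of_nonneg (by positivity)]
        gcongr
      have hn2 : ‖(L * s) ^ kn.1 / (Nat.factorial kn.1 : ℝ)‖ ≤
          (|L| * x) ^ kn.1 / (Nat.factorial kn.1 : ℝ) := by
        rw [norm_div, norm_pow, norm_mul, Real.norm_of_nonneg h0.le, Real.norm_natCast,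
          Real.norm_eq_abs]
        gcongr
      gcongr
    · exact Filter.Eventually.of_forall fun s _ => hB
    · exact intervalIntegrable_const
    · refine Filter.Eventually.of_forall fun s hs => ?_
      rw [Set.uIoc_of_le hx] at hs
      obtain ⟨h0, h1⟩ := hs
      have hs2n : Summable fun n : ℕ => ‖(x + 2 * n + 2) * s ^ n * (x - s) ^ n /
          ((Nat.factorial n : ℝ) * (Nat.factorial (n + 1) : ℝ))‖ :=
        Summable.of_nonneg_of_le (fun _ => norm_nonneg _) (cb_bound x s h0.le h1)
          ((Real.summable_pow_div_factorial (x * x)).mul_left (x + 2))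
      have hs1n : Summable fun k : ℕ => ‖(L * s) ^ k / (Nat.factorial k : ℝ)‖ :=
        (Real.summable_pow_div_factorial (L * s)).norm
      have a1 : HasSum (fun k : ℕ => (L * s) ^ k / (Nat.factorial k : ℝ)) (Real.exp (L * s)) := by
        rw [Real.exp_eq_exp_ℝ]
        exact NormedSpace.expSeries_div_hasSum_exp (L * s)
      have a2 : HasSum (fun n : ℕ => (x + 2 * n + 2) * s ^ n * (x - s) ^ n /
          ((Nat.factorial n : ℝ) * (Nat.factorial (n + 1) : ℝ))) (contBinom x s) :=
        hs2n.of_norm.hasSum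
      have a4 := cb_mul _ _ _ _ a1 a2 hs1n hs2n
      have a3 := a4.mul_left ((1 - p) ^ x * s ^ l)
      have e : s ^ l * contBinom x s * p ^ s * (1 - p) ^ (x - s) =
          (1 - p) ^ x * s ^ l * (Real.exp (L * s) * contBinom x s) := by
        have : Real.exp (L * s) = p ^ s / (1 - p) ^ s := by
          rw [← Real.div_rpow hp0.le hq0.le, Real.rpow_def_of_pos (by positivity)]
        rw [this, Real.rpow_sub hq0]
        ring
      rw [e]
      exact a3
  rw [← key.tsum_eq, ← tsum_mul_left]
  refine tsum_congr fun kn => ?_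
  obtain ⟨k, n⟩ := kn
  simp only [F]
  have e : ∀ s : ℝ, (1 - p) ^ x * s ^ l * ((L * s) ^ k / (Nat.factorial k : ℝ) *
      ((x + 2 * n + 2) * s ^ n * (x - s) ^ n /
        ((Nat.factorial n : ℝ) * (Nat.factorial (n + 1) : ℝ)))) =
      ((1 - p) ^ x * L ^ k * (x + 2 * n + 2) / ((Nat.factorial k : ℝ) *
        ((Nat.factorial n : ℝ) * (Nat.factorial (n + 1) : ℝ)))) *
        (s ^ (n + k + l) * (x - s) ^ n) := by
    intro s
    ring
  simp_rw [e]
  rw [intervalIntegral.integral_const_mul, cb_beta]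
  have e1 : n + k + l + n + 1 = 2 * n + k + l + 1 := by ring
  rw [e1]
  have c1 : (Nat.choose (n + k + l) n : ℝ) * (Nat.factorial n : ℝ) * (Nat.factorial (k + l) : ℝ)
      = (Nat.factorial (n + k + l) : ℝ) := by
    have := Nat.choose_mul_factorial_mul_factorial (show n ≤ n + k + l by omega)
    rw [show n + k + l - n = k + l by omega] at this
    exact_mod_cast this
  have c2 : (Nat.factorial k : ℝ) * (Nat.descFactorial (k + l) l : ℝ)
      = (Nat.factorial (k + l) : ℝ) := by
    have := Nat.factorial_mul_descFactorial (show l ≤ k + l by omega)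
    rw [Nat.add_sub_cancel] at this
    exact_mod_cast this
  have hk : (Nat.factorial k : ℝ) ≠ 0 := by positivity
  rw [← c1, ← c2, Nat.factorial_succ n]
  push_cast
  have hn : (Nat.factorial n : ℝ) ≠ 0 := by positivity
  have hM : (Nat.factorial (2 * n + k + l + 1) : ℝ) ≠ 0 := by positivity
  have hn1 : (n : ℝ) + 1 ≠ 0 := by positivity
  have hn2 : (2 * n + 2 : ℝ) = 2 * ((n : ℝ) + 1) := by ring
  rw [hn2]
  rw [pow_succ x (2 * n + k + l + 1)]
  generalize (Nat.factorial (2 * n + k + l + 1) : ℝ) = M at *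
  generalize x ^ (2 * n + k + l + 1) = X
  generalize (Nat.factorial n : ℝ) = N at *
  generalize (Nat.factorial k : ℝ) = K at *
  generalize (1 - p) ^ x = Q
  generalize L ^ k = LK
  field_simp
  ring
end

section
/- The centered continuous binomial densities converge weakly to the Dirac delta at 0 as x → 0⁺: for every continuous function f : ℝ → ℝ, lim_{x → 0⁺} ∫_{−x/2}^{x/2} f(s) · d_x(s) ds = f(0), where d_x(s) = {x brace x/2 + s}/(2(e^x − 1)). -/
theorem contBinom_continuous_aux : Continuous (fun p : ℝ × ℝ => contBinom p.1 p.2) := by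
  rw [continuous_iff_continuousAt]
  intro p
  set R : ℝ := ‖p‖ + 1 with hR
  have hR0 : 0 ≤ R := by positivity
  have hon : ContinuousOn (fun p : ℝ × ℝ => contBinom p.1 p.2) (Metric.ball 0 R) := by
    unfold contBinom
    refine continuousOn_tsum (u := fun n : ℕ => (R + 2) * ((R * (2 * R)) ^ n / (Nat.factorial n : ℝ)))
      (fun n => ?_) ((Real.summable_pow_div_factorial _).mul_left _) ?_
    · exact Continuous.continuousOn (by fun_prop)
    · rintro n ⟨x, s⟩ hq
      rw [mem_ball_zero_iff] at hq
      have hx : |x| ≤ R := (norm_fst_le (x, s)).trans hq.le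
      have hs : |s| ≤ R := (norm_snd_le (x, s)).trans hq.le
      have hxs : |x - s| ≤ 2 * R := (abs_sub x s).trans (by linarith)
      have hfac : ((n : ℝ) + 1) ≤ (Nat.factorial (n + 1) : ℝ) := by
        exact_mod_cast Nat.self_le_factorial (n + 1)
      have hn : (0 : ℝ) ≤ n := Nat.cast_nonneg n
      have h1 : |x + 2 * n + 2| ≤ (R + 2) * (Nat.factorial (n + 1) : ℝ) := by
        have : |x + 2 * n + 2| ≤ (R + 2) * ((n : ℝ) + 1) := by
          rw [abs_le] at hx ⊢
          constructor <;> nlinarith [mul_nonneg hR0 hn]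
        exact this.trans (by gcongr)
      have hp1 : (0 : ℝ) < Nat.factorial n := by positivity
      have hp2 : (0 : ℝ) < Nat.factorial (n + 1) := by positivity
      rw [Real.norm_eq_abs, abs_div, abs_mul, abs_mul, abs_pow, abs_pow,
        abs_of_pos (mul_pos hp1 hp2), div_le_iff₀ (mul_pos hp1 hp2)]
      calc |x + 2 * n + 2| * |s| ^ n * |x - s| ^ n
          ≤ ((R + 2) * (Nat.factorial (n + 1) : ℝ)) * R ^ n * (2 * R) ^ n := by gcongr
        _ = _ := by
          rw [mul_pow R]
          field_simp
  refine hon.continuousAt (Metric.isOpen_ball.mem_nhds ?_)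
  rw [mem_ball_zero_iff]
  linarith

theorem contBinom_zero_aux : contBinom 0 0 = 2 := by
  unfold contBinom
  rw [tsum_eq_single 0]
  · simp
  · intro n hn
    simp [hn]

theorem contBinom_exp_aux :
    Filter.Tendsto (fun x : ℝ => x / (2 * (Real.exp x - 1))) (nhdsWithin 0 (Set.Ioi 0))
      (nhds (1 / 2)) := by
  have h := (Real.hasDerivAt_exp 0).tendsto_slope_zero_right
  simp only [zero_add, Real.exp_zero, smul_eq_mul] at h
  have h2 := (h.inv₀ one_ne_zero).div_const 2
  rw [inv_one] at h2
  refine h2.congr fun x => ?_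
  rw [mul_inv, inv_inv, div_eq_mul_inv, div_eq_mul_inv, mul_inv]
  ring

/-- the centered continuous binomial densities
`d_x(s) = {x brace x/2+s}/(2(eˣ−1))` converge weakly to the Dirac delta at `0`
as `x → 0⁺`: for every continuous `f : ℝ → ℝ`,
`∫_{−x/2}^{x/2} f(s) d_x(s) ds → f 0`. -/
theorem contBinom_density_tendsto_delta (f : ℝ → ℝ) (hf : Continuous f) :
    Filter.Tendsto
      (fun x : ℝ =>
        ∫ s in (-(x / 2))..(x / 2),
          f s * (contBinom x (x / 2 + s) / (2 * (Real.exp x - 1))))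
      (nhdsWithin 0 (Set.Ioi 0)) (nhds (f 0)) := by
  have hc := contBinom_continuous_aux
  have hcont : Continuous (fun x : ℝ => ∫ u in (-(1 / 2) : ℝ)..(1 / 2),
      f (x * u) * contBinom x (x / 2 + x * u)) := by
    apply intervalIntegral.continuous_parametric_intervalIntegral_of_continuous'
    have h2 : Continuous (fun q : ℝ × ℝ => contBinom q.1 (q.1 / 2 + q.1 * q.2)) :=
      hc.comp (by fun_prop : Continuous fun q : ℝ × ℝ => (q.1, q.1 / 2 + q.1 * q.2))
    exact (hf.comp (by fun_prop : Continuous fun q : ℝ × ℝ => q.1 * q.2)).mul h2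
  have h0 := (hcont.tendsto 0).mono_left (nhdsWithin_le_nhds (s := Set.Ioi 0))
  have h1 := h0.mul contBinom_exp_aux
  have hv : (∫ u in (-(1 / 2) : ℝ)..(1 / 2),
      f (0 * u) * contBinom 0 (0 / 2 + 0 * u)) * (1 / 2) = f 0 := by
    simp only [zero_mul, zero_div, add_zero, contBinom_zero_aux, intervalIntegral.integral_const,
      smul_eq_mul]
    ring
  rw [hv] at h1
  refine h1.congr fun x => ?_
  have h3 := intervalIntegral.mul_integral_comp_mul_left (a := -(1 / 2)) (b := 1 / 2)
    (f := fun s => f s * (contBinom x (x / 2 + s) / (2 * (Real.exp x - 1)))) x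
  rw [show x * -(1 / 2) = -(x / 2) by ring, show x * (1 / 2) = x / 2 by ring] at h3
  rw [← h3, ← intervalIntegral.integral_const_mul, ← intervalIntegral.integral_mul_const]
  congr 1
  ext u
  ring
end

section
/- For all real t ≥ 0 and s ≥ 0, {(t+1)s brace s} = 2 + s + ∑_{n=1}^∞ (t^n/n!) · [ 2·(2n)_n · s^{2n}/(2n)! + (2n+1)_n · s^{2n+1}/(2n+1)! + (2n−1)_n · s^{2n−1}/(2n−1)! ], where (a)_m = a(a−1)⋯(a−m+1) denotes the falling factorial. In particular all coefficients of this two-variable expansion in t and s are non-negative integers. -/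
theorem desc_div (a k : ℕ) (h : k ≤ a) :
    (Nat.descFactorial a k : ℝ) / (Nat.factorial a : ℝ) = 1 / (Nat.factorial (a - k) : ℝ) := by
  have h1 : ((Nat.factorial (a - k) : ℕ) : ℝ) * (Nat.descFactorial a k : ℝ)
      = (Nat.factorial a : ℝ) := by
    exact_mod_cast Nat.factorial_mul_descFactorial h
  have h2 : (Nat.factorial (a - k) : ℝ) ≠ 0 := by positivity
  have h3 : (Nat.factorial a : ℝ) ≠ 0 := by positivity
  field_simp
  linarith

theorem summable_aux (c y : ℝ) (hc : 0 ≤ c) (hy : 0 ≤ y) (k : ℕ) :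
    Summable (fun n : ℕ => c * (y ^ n / ((Nat.factorial n : ℝ) * (Nat.factorial (n + k) : ℝ)))) := by
  apply Summable.mul_left
  refine Summable.of_nonneg_of_le (fun n => by positivity) (fun n => ?_)
    (Real.summable_pow_div_factorial y)
  have h1 : (1 : ℝ) ≤ (Nat.factorial (n + k) : ℝ) := by
    exact_mod_cast Nat.one_le_iff_ne_zero.mpr (Nat.factorial_ne_zero _)
  have h2 : (0 : ℝ) < (Nat.factorial n : ℝ) := by positivity
  apply div_le_div_of_nonneg_left (by positivity) h2
  nlinarith

/-- the expansion of `{(t+1)s brace s}` with non-negative integer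
coefficients; `Nat.descFactorial a m` is the falling factorial `(a)_m`.
(The sum over `n ≥ 1` is written as a sum over `m : ℕ` with `n = m + 1`.) -/
theorem contBinom_shift_expansion (t s : ℝ) (ht : 0 ≤ t) (hs : 0 ≤ s) :
    contBinom ((t + 1) * s) s =
      2 + s + ∑' m : ℕ,
        (t ^ (m + 1) / (Nat.factorial (m + 1) : ℝ)) *
          (2 * (Nat.descFactorial (2 * (m + 1)) (m + 1) : ℝ) *
              s ^ (2 * (m + 1)) / (Nat.factorial (2 * (m + 1)) : ℝ) +
            (Nat.descFactorial (2 * (m + 1) + 1) (m + 1) : ℝ) *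
              s ^ (2 * (m + 1) + 1) / (Nat.factorial (2 * (m + 1) + 1) : ℝ) +
            (Nat.descFactorial (2 * (m + 1) - 1) (m + 1) : ℝ) *
              s ^ (2 * (m + 1) - 1) / (Nat.factorial (2 * (m + 1) - 1) : ℝ)) := by
  have hA0 := summable_aux 2 (t * s ^ 2) (by norm_num) (by positivity) 0
  have hA1 := summable_aux s (t * s ^ 2) hs (by positivity) 1
  have hB := summable_aux (t * s) (t * s ^ 2) (by positivity) (by positivity) 1
  have hA := hA0.add hA1
  have e1 : contBinom ((t + 1) * s) s = ∑' n : ℕ,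
      ((2 * ((t * s ^ 2) ^ n / ((Nat.factorial n : ℝ) * (Nat.factorial (n + 0) : ℝ))) +
        s * ((t * s ^ 2) ^ n / ((Nat.factorial n : ℝ) * (Nat.factorial (n + 1) : ℝ)))) +
        (t * s) * ((t * s ^ 2) ^ n / ((Nat.factorial n : ℝ) * (Nat.factorial (n + 1) : ℝ)))) := by
    unfold contBinom
    refine tsum_congr (fun n => ?_)
    have h2 : (Nat.factorial n : ℝ) ≠ 0 := by positivity
    have h3 : (n : ℝ) + 1 ≠ 0 := by positivity
    have h4 : (t + 1) * s - s = t * s := by ring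
    rw [h4, Nat.add_zero, Nat.factorial_succ]
    push_cast
    rw [mul_pow, mul_pow, ← pow_mul]
    field_simp
    ring_nf
  have hA' := (summable_nat_add_iff 1).mpr hA
  rw [e1, hA.tsum_add hB, hA.tsum_eq_zero_add, add_assoc, ← hA'.tsum_add hB]
  congr 1
  · simp
  refine tsum_congr (fun m => ?_)
  have d1 := desc_div (2 * (m + 1)) (m + 1) (by omega)
  have d2 := desc_div (2 * (m + 1) + 1) (m + 1) (by omega)
  have d3 := desc_div (2 * (m + 1) - 1) (m + 1) (by omega)
  rw [show 2 * (m + 1) - (m + 1) = m + 1 by omega] at d1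
  rw [show 2 * (m + 1) + 1 - (m + 1) = m + 1 + 1 by omega] at d2
  rw [show 2 * (m + 1) - 1 - (m + 1) = m by omega] at d3
  rw [mul_assoc 2, mul_div_assoc 2, mul_div_right_comm, d1,
    mul_div_right_comm (Nat.descFactorial (2 * (m + 1) + 1) (m + 1) : ℝ), d2,
    mul_div_right_comm (Nat.descFactorial (2 * (m + 1) - 1) (m + 1) : ℝ), d3,
    show 2 * (m + 1) - 1 = 2 * m + 1 by omega, Nat.add_zero]
  have f1 : (Nat.factorial m : ℝ) ≠ 0 := by positivity
  have f2 : (Nat.factorial (m + 1) : ℝ) ≠ 0 := by positivity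
  have f3 : (Nat.factorial (m + 1 + 1) : ℝ) ≠ 0 := by positivity
  rw [mul_pow, mul_pow, ← pow_mul, ← pow_mul]
  field_simp
  ring
end

section
/- For every real s ≥ 0, the midpoint continuous binomial coefficient satisfies {2s brace s} = 2·∑_{n=0}^∞ C(n, ⌊n/2⌋) · s^n/n!; that is, {2s brace s} is twice the exponential generating function of the midpoint binomial coefficients C(n, ⌊n/2⌋). -/
/-- Splitting a summable series into even and odd terms. -/
theorem tsum_split_parity (f : ℕ → ℝ) (hf : Summable f) :
    ∑' n, f n = ∑' n, (f (2 * n) + f (2 * n + 1)) := by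
  have he : Summable (fun n : ℕ => f (2 * n)) :=
    hf.comp_injective (i := fun n : ℕ => 2 * n) (fun a b h => by simpa using h)
  have ho : Summable (fun n : ℕ => f (2 * n + 1)) :=
    hf.comp_injective (i := fun n : ℕ => 2 * n + 1) (fun a b h => by simpa using h)
  rw [← tsum_even_add_odd he ho, he.tsum_add ho]

/-- the midpoint continuous binomial coefficient `{2s brace s}` is
twice the exponential generating function of the midpoint binomial coefficients
`C(n, ⌊n/2⌋)`. -/
theorem contBinom_midpoint (s : ℝ) (hs : 0 ≤ s) :
    contBinom (2 * s) s =
      2 * ∑' n : ℕ, (Nat.choose n (n / 2) : ℝ) * s ^ n / (Nat.factorial n : ℝ) := by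
  have hsum : Summable (fun n : ℕ => (Nat.choose n (n / 2) : ℝ) * s ^ n / (Nat.factorial n : ℝ)) := by
    refine Summable.of_nonneg_of_le (fun n => by positivity) (fun n => ?_)
      (Real.summable_pow_div_factorial (2 * s))
    have h : (Nat.choose n (n / 2) : ℝ) ≤ 2 ^ n := by
      exact_mod_cast Nat.choose_le_two_pow n (n / 2)
    rw [mul_pow]
    gcongr
  rw [tsum_split_parity _ hsum, ← tsum_mul_left, contBinom]
  refine tsum_congr (fun n => ?_)
  have h1 : 2 * n / 2 = n := by omega
  have h2 : (2 * n + 1) / 2 = n := by omega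
  rw [h1, h2, Nat.cast_choose ℝ (show n ≤ 2 * n by omega),
    Nat.cast_choose ℝ (show n ≤ 2 * n + 1 by omega)]
  have h3 : 2 * n - n = n := by omega
  have h4 : 2 * n + 1 - n = n + 1 := by omega
  rw [h3, h4]
  have f1 : (Nat.factorial n : ℝ) ≠ 0 := by positivity
  have f2 : (Nat.factorial (2 * n) : ℝ) ≠ 0 := by positivity
  have f3 : (Nat.factorial (2 * n + 1) : ℝ) ≠ 0 := by positivity
  have f4 : (n : ℝ) + 1 ≠ 0 := by positivity
  have e1 : ∀ a b c : ℝ, a ≠ 0 → a / b * c / a = c / b := by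
    intro a b c ha
    rw [div_mul_eq_mul_div, div_div, mul_comm b a, mul_div_mul_left _ _ ha]
  rw [e1 _ _ _ f2, e1 _ _ _ f3, Nat.factorial_succ n]
  push_cast
  have h5 : 2 * s - s = s := by ring
  rw [h5]
  field_simp
  ring
end

section
/- For real numbers 0 ≤ y ≤ x and every integer n ≥ 0, the volumes of the moduli polytopes satisfy the recursion vol(Λ^{n+1}(x,y)) = ∫_0^{(x−y)/2} ∫_0^{(x+y)/2 − b} vol(Λ^n(a+2b, a)) da db. -/
open MeasureTheory

/-- The convex polytope `Λⁿ(x,y)` of tuples `(x₁,…,xₙ,y₁,…,yₙ)` with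
`0 ≤ x₁ ≤ ⋯ ≤ xₙ ≤ (x+y)/2`, `0 ≤ y₁ ≤ ⋯ ≤ yₙ ≤ (x−y)/2` and `yᵢ ≤ xᵢ`. -/
def LambdaSet (n : ℕ) (x y : ℝ) : Set ((Fin n → ℝ) × (Fin n → ℝ)) :=
  {p | (∀ i, 0 ≤ p.1 i) ∧ (∀ i, p.1 i ≤ (x + y) / 2) ∧ Monotone p.1 ∧
       (∀ i, 0 ≤ p.2 i) ∧ (∀ i, p.2 i ≤ (x - y) / 2) ∧ Monotone p.2 ∧
       (∀ i, p.2 i ≤ p.1 i)}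

/-- The `2n`-dimensional volume of `Λⁿ(x,y)`; for `n = 0` the ambient space is a
point of measure one, so `lambdaVol 0 x y = 1`, matching the convention
`vol(Λ⁰(x,y)) = 1`. -/
noncomputable def lambdaVol (n : ℕ) (x y : ℝ) : ℝ :=
  (volume (LambdaSet n x y)).toReal

lemma mp_comm4 {α β γ δ : Type*} [MeasureSpace α] [MeasureSpace β] [MeasureSpace γ]
    [MeasureSpace δ] [SigmaFinite (volume : Measure α)] [SigmaFinite (volume : Measure β)]
    [SigmaFinite (volume : Measure γ)] [SigmaFinite (volume : Measure δ)] :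
    MeasurePreserving (fun p : (α × β) × (γ × δ) => ((p.1.1, p.2.1), (p.1.2, p.2.2))) := by
  have h1 := measurePreserving_prodAssoc (volume : Measure α) (volume : Measure β)
    (volume : Measure (γ × δ))
  have h2 := (measurePreserving_prodAssoc (volume : Measure β) (volume : Measure γ)
    (volume : Measure δ)).symm
  have h3 := (Measure.measurePreserving_swap (μ := (volume : Measure β))
    (ν := (volume : Measure γ))).prod (MeasurePreserving.id (volume : Measure δ))
  have h4 := measurePreserving_prodAssoc (volume : Measure γ) (volume : Measure β)
    (volume : Measure δ)
  have h5 := (MeasurePreserving.id (volume : Measure α)).prod (h4.comp (h3.comp h2))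
  have h6 := (measurePreserving_prodAssoc (volume : Measure α) (volume : Measure γ)
    (volume : Measure (β × δ))).symm
  exact h6.comp (h5.comp h1)

lemma mp_split (n : ℕ) :
    MeasurePreserving (fun p : (Fin (n + 1) → ℝ) × (Fin (n + 1) → ℝ) =>
      ((p.1 (Fin.last n), p.2 (Fin.last n)),
        ((fun i : Fin n => p.1 i.castSucc), (fun i : Fin n => p.2 i.castSucc)))) := by
  have h := volume_preserving_piFinSuccAbove (fun _ : Fin (n + 1) => ℝ) (Fin.last n)
  have h2 := (mp_comm4 (α := ℝ) (β := Fin n → ℝ) (γ := ℝ) (δ := Fin n → ℝ)).comp (h.prod h)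
  rw [← Measure.volume_eq_prod] at h2
  convert h2 using 1
  funext p
  simp [MeasurableEquiv.piFinSuccAbove, Fin.insertNthEquiv]
  constructor <;> rfl

lemma mono_snoc {n : ℕ} (f : Fin (n + 1) → ℝ) :
    Monotone f ↔ (Monotone (fun i : Fin n => f i.castSucc) ∧
      ∀ i : Fin n, f i.castSucc ≤ f (Fin.last n)) := by
  constructor
  · intro h
    exact ⟨fun i j hij => h (by simpa using hij), fun i => h (Fin.le_last _)⟩
  · rintro ⟨h1, h2⟩ i j hij
    induction j using Fin.lastCases with
    | last =>
      induction i using Fin.lastCases with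
      | last => exact le_rfl
      | cast i => exact h2 i
    | cast j =>
      induction i using Fin.lastCases with
      | last => exact absurd hij (not_le.2 (Fin.castSucc_lt_last j))
      | cast i => exact h1 (by simpa using hij)

lemma closed_graph (n : ℕ) : IsClosed {q : (ℝ × ℝ) × ((Fin n → ℝ) × (Fin n → ℝ)) |
    q.2 ∈ LambdaSet n (q.1.1 + q.1.2) (q.1.1 - q.1.2)} := by
  simp only [LambdaSet, Set.mem_ofPred_eq, Monotone]
  simp only [Set.ofPred_and, Set.ofPred_forall]
  refine IsClosed.inter ?_ (IsClosed.inter ?_ (IsClosed.inter ?_ (IsClosed.inter ?_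
    (IsClosed.inter ?_ (IsClosed.inter ?_ ?_)))))
  all_goals
    repeat (refine isClosed_iInter fun _ => ?_)
    exact isClosed_le (by fun_prop) (by fun_prop)

lemma finite_vol (n : ℕ) (x y : ℝ) : volume (LambdaSet n x y) < ⊤ := by
  refine lt_of_le_of_lt (measure_mono ?_) (isCompact_Icc
    (a := ((fun _ => 0, fun _ => 0) : (Fin n → ℝ) × (Fin n → ℝ)))
    (b := (fun _ => (x + y) / 2, fun _ => (x - y) / 2))).measure_lt_top
  rintro p ⟨h1, h2, -, h4, h5, -⟩
  exact ⟨⟨h1, h4⟩, ⟨h2, h5⟩⟩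

/-- The region of admissible last coordinates. -/
def lastRegion (A B : ℝ) : Set (ℝ × ℝ) := {q | 0 ≤ q.2 ∧ q.2 ≤ B ∧ q.2 ≤ q.1 ∧ q.1 ≤ A}

lemma closed_lastRegion (A B : ℝ) : IsClosed (lastRegion A B) := by
  simp only [lastRegion, Set.ofPred_and]
  refine IsClosed.inter ?_ (IsClosed.inter ?_ (IsClosed.inter ?_ ?_)) <;>
    exact isClosed_le (by fun_prop) (by fun_prop)

lemma meas_vol (n : ℕ) :
    Measurable (fun q : ℝ × ℝ => volume (LambdaSet n (q.1 + q.2) (q.1 - q.2))) :=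
  measurable_measure_prodMk_left (closed_graph n).measurableSet

lemma vol_succ (n : ℕ) (x y : ℝ) : volume (LambdaSet (n + 1) x y) =
    ∫⁻ q in lastRegion ((x + y) / 2) ((x - y) / 2),
      volume (LambdaSet n (q.1 + q.2) (q.1 - q.2)) := by
  set T := lastRegion ((x + y) / 2) ((x - y) / 2) with hT
  have hTm : MeasurableSet T := (closed_lastRegion _ _).measurableSet
  set S : Set ((ℝ × ℝ) × ((Fin n → ℝ) × (Fin n → ℝ))) :=
    {q | q.2 ∈ LambdaSet n (q.1.1 + q.1.2) (q.1.1 - q.1.2)} ∩ (Prod.fst ⁻¹' T) with hS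
  have hSm : MeasurableSet S := (closed_graph n).measurableSet.inter (measurable_fst hTm)
  have hpre : LambdaSet (n + 1) x y = (fun p : (Fin (n + 1) → ℝ) × (Fin (n + 1) → ℝ) =>
      ((p.1 (Fin.last n), p.2 (Fin.last n)),
        ((fun i : Fin n => p.1 i.castSucc), (fun i : Fin n => p.2 i.castSucc)))) ⁻¹' S := by
    ext ⟨u, v⟩
    have e1 : ∀ a b : ℝ, (a + b + (a - b)) / 2 = a := fun a b => by ring
    have e2 : ∀ a b : ℝ, (a + b - (a - b)) / 2 = b := fun a b => by ring
    simp only [hS, hT, lastRegion, LambdaSet, Set.mem_ofPred_eq, Set.mem_preimage, Set.mem_inter_iff,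
      mono_snoc u, mono_snoc v, Fin.forall_fin_succ', e1, e2]
    constructor
    · rintro ⟨⟨a1, a2⟩, ⟨b1, b2⟩, ⟨c1, c2⟩, ⟨d1, d2⟩, ⟨f1, f2⟩, ⟨g1, g2⟩, ⟨k1, k2⟩⟩
      exact ⟨⟨a1, c2, c1, d1, g2, g1, k1⟩, d2, f2, k2, b2⟩
    · rintro ⟨⟨a1, c2, c1, d1, g2, g1, k1⟩, d2, f2, k2, b2⟩
      exact ⟨⟨a1, d2.trans k2⟩, ⟨fun i => (c2 i).trans b2, b2⟩, ⟨c1, c2⟩, ⟨d1, d2⟩,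
        ⟨fun i => (g2 i).trans f2, f2⟩, ⟨g1, g2⟩, ⟨k1, k2⟩⟩
  rw [hpre, (mp_split n).measure_preimage hSm.nullMeasurableSet, Measure.volume_eq_prod,
    Measure.prod_apply hSm, ← lintegral_indicator hTm]
  refine lintegral_congr fun q => ?_
  by_cases hq : q ∈ T
  · rw [Set.indicator_of_mem hq]
    congr 1
    ext p
    simp [hS, hq]
  · rw [Set.indicator_of_notMem hq]
    have : Prod.mk q ⁻¹' S = ∅ := by
      ext p
      simp [hS, hq]
    rw [this, measure_empty]

/-- the recursion
`vol(Λⁿ⁺¹(x,y)) = ∫₀^{(x−y)/2} ∫₀^{(x+y)/2−b} vol(Λⁿ(a+2b,a)) da db`. -/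
theorem lambdaVol_recursion (x y : ℝ) (hy : 0 ≤ y) (hyx : y ≤ x) (n : ℕ) :
    lambdaVol (n + 1) x y =
      ∫ b in (0 : ℝ)..((x - y) / 2),
        ∫ a in (0 : ℝ)..((x + y) / 2 - b), lambdaVol n (a + 2 * b) a := by
  have hTm := (closed_lastRegion ((x + y) / 2) ((x - y) / 2)).measurableSet
  have hfin : ∫⁻ q in lastRegion ((x + y) / 2) ((x - y) / 2),
      volume (LambdaSet n (q.1 + q.2) (q.1 - q.2)) ≠ ⊤ := by
    rw [← vol_succ]; exact (finite_vol _ _ _).ne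
  have hint := (integrable_toReal_of_lintegral_ne_top (meas_vol n).aemeasurable hfin)
  rw [lambdaVol, vol_succ, ← integral_toReal (meas_vol n).aemeasurable
    (Filter.Eventually.of_forall fun q => finite_vol _ _ _), ← integral_indicator hTm,
    Measure.volume_eq_prod, integral_prod_symm _ (by
      rw [← Measure.volume_eq_prod]; exact (integrable_indicator_iff hTm).2 hint),
    intervalIntegral.integral_of_le (by linarith), ← integral_Icc_eq_integral_Ioc,
    ← integral_indicator measurableSet_Icc]
  congr 1
  funext b
  by_cases hb : b ∈ Set.Icc 0 ((x - y) / 2)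
  · rw [Set.indicator_of_mem hb]
    have h := intervalIntegral.integral_comp_add_right (a := 0) (b := (x + y) / 2 - b)
      (fun s => lambdaVol n (s + b) (s - b)) b
    have h' : ∀ a : ℝ, lambdaVol n (a + b + b) (a + b - b) = lambdaVol n (a + 2 * b) a := by
      intro a; congr 1 <;> ring
    simp only [h'] at h
    rw [h, zero_add, sub_add_cancel, intervalIntegral.integral_of_le (by linarith [hb.2]),
      ← integral_Icc_eq_integral_Ioc, ← integral_indicator measurableSet_Icc]
    congr 1
    funext s
    have : (s, b) ∈ lastRegion ((x + y) / 2) ((x - y) / 2) ↔ s ∈ Set.Icc b ((x + y) / 2) := by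
      simp [lastRegion, hb.1, hb.2]
    by_cases hs : s ∈ Set.Icc b ((x + y) / 2)
    · rw [Set.indicator_of_mem hs, Set.indicator_of_mem (this.2 hs)]; rfl
    · rw [Set.indicator_of_notMem hs, Set.indicator_of_notMem (fun h => hs (this.1 h))]
  · rw [Set.indicator_of_notMem hb]
    refine integral_eq_zero_of_ae (Filter.Eventually.of_forall fun s => ?_)
    exact Set.indicator_of_notMem (fun h => hb ⟨h.1, h.2.1⟩) _
end

section
/- The two-variable continuous Catalan function C(x,y) = ∑_{n=0}^∞ vol(Λ^n(x,y)) satisfies, for all real 0 ≤ y ≤ x, the integral equation C(x,y) = 1 + ∫_0^{(x−y)/2} ∫_0^{(x+y)/2 − b} C(a+2b, a) da db. -/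
open MeasureTheory

/-- The two-variable continuous Catalan function `C(x,y) = ∑ₙ vol(Λⁿ(x,y))`. -/
noncomputable def catalanFun2 (x y : ℝ) : ℝ := ∑' n : ℕ, lambdaVol n x y


namespace CatAux

open Set

/-- The polytope in the coordinates `u = (x+y)/2`, `v = (x-y)/2`. -/
def PSet (n : ℕ) (u v : ℝ) : Set ((Fin n → ℝ) × (Fin n → ℝ)) :=
  {p | (∀ i, 0 ≤ p.1 i) ∧ (∀ i, p.1 i ≤ u) ∧ Monotone p.1 ∧
       (∀ i, 0 ≤ p.2 i) ∧ (∀ i, p.2 i ≤ v) ∧ Monotone p.2 ∧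
       (∀ i, p.2 i ≤ p.1 i)}

/-- The set of all parameters and points of the polytopes. -/
def BigSet (n : ℕ) : Set ((ℝ × ℝ) × ((Fin n → ℝ) × (Fin n → ℝ))) :=
  {z | z.2 ∈ PSet n z.1.1 z.1.2}

lemma measurableSet_bigSet (n : ℕ) : MeasurableSet (BigSet n) := by
  apply IsClosed.measurableSet
  have : BigSet n = {z | (∀ i, 0 ≤ z.2.1 i) ∧ (∀ i, z.2.1 i ≤ z.1.1) ∧
      (∀ i j, i ≤ j → z.2.1 i ≤ z.2.1 j) ∧
       (∀ i, 0 ≤ z.2.2 i) ∧ (∀ i, z.2.2 i ≤ z.1.2) ∧ (∀ i j, i ≤ j → z.2.2 i ≤ z.2.2 j) ∧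
       (∀ i, z.2.2 i ≤ z.2.1 i)} := rfl
  rw [this]
  simp only [ofPred_and, ofPred_forall]
  refine IsClosed.inter ?_ (IsClosed.inter ?_ (IsClosed.inter ?_ (IsClosed.inter ?_
    (IsClosed.inter ?_ (IsClosed.inter ?_ ?_)))))
  all_goals
    refine isClosed_iInter fun i => ?_
    try refine isClosed_iInter fun j => ?_
    try refine isClosed_iInter fun hij => ?_
    exact isClosed_le (by fun_prop) (by fun_prop)

/-- The extended-real volume. -/
noncomputable def L (n : ℕ) (u v : ℝ) : ENNReal := volume (PSet n u v)

lemma measurable_L (n : ℕ) : Measurable fun z : ℝ × ℝ => L n z.1 z.2 :=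
  measurable_measure_prodMk_left (ν := (volume : Measure ((Fin n → ℝ) × (Fin n → ℝ))))
    (measurableSet_bigSet n)

lemma measurableSet_PSet (n : ℕ) (u v : ℝ) : MeasurableSet (PSet n u v) :=
  measurable_prodMk_left (x := (u, v)) (measurableSet_bigSet n)

lemma lintegral_snoc (n : ℕ) (f : (Fin (n + 1) → ℝ) → ENNReal) (hf : Measurable f) :
    ∫⁻ p, f p = ∫⁻ s : ℝ, ∫⁻ q : Fin n → ℝ, f ((Fin.last n).insertNth s q) := by
  have h := volume_preserving_piFinSuccAbove (fun _ : Fin (n + 1) => ℝ) (Fin.last n)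
  have h2 := h.symm.lintegral_comp hf
  rw [← h2]
  have : (volume : Measure (ℝ × (Fin n → ℝ))) = (volume : Measure ℝ).prod volume := rfl
  erw [lintegral_prod]
  · rfl
  · exact (hf.comp (MeasurableEquiv.measurable _)).aemeasurable

lemma measurable_ins (n : ℕ) : Measurable fun z : ℝ × (Fin n → ℝ) =>
    ((Fin.last n).insertNth z.1 z.2 : Fin (n + 1) → ℝ) :=
  (MeasurableEquiv.piFinSuccAbove (fun _ : Fin (n + 1) => ℝ) (Fin.last n)).symm.measurable

lemma mono_ins (n : ℕ) (s : ℝ) (p : Fin n → ℝ) :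
    Monotone ((Fin.last n).insertNth s p : Fin (n + 1) → ℝ) ↔ Monotone p ∧ ∀ i, p i ≤ s := by
  have e1 : ((Fin.last n).insertNth s p : Fin (n + 1) → ℝ) (Fin.last n) = s := by simp
  have e2 : ∀ i : Fin n, ((Fin.last n).insertNth s p : Fin (n + 1) → ℝ) i.castSucc = p i := by
    intro i; simp
  constructor
  · intro h
    refine ⟨fun i j hij => ?_, fun i => ?_⟩
    · have := h (Fin.castSucc_le_castSucc_iff.2 hij)
      rwa [e2, e2] at this
    · have := h (Fin.le_last i.castSucc)
      rwa [e2, e1] at this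
  · rintro ⟨h1, h2⟩ i j hij
    induction j using Fin.lastCases with
    | last =>
      induction i using Fin.lastCases with
      | last => exact le_rfl
      | cast i => rw [e1, e2]; exact h2 i
    | cast j =>
      induction i using Fin.lastCases with
      | last => exact absurd hij (not_le.2 (Fin.castSucc_lt_last j))
      | cast i => rw [e2, e2]; exact h1 (Fin.castSucc_le_castSucc_iff.1 hij)

lemma mem_succ (n : ℕ) (u v s t : ℝ) (p q : Fin n → ℝ) :
    (((Fin.last n).insertNth s p : Fin (n + 1) → ℝ),
      ((Fin.last n).insertNth t q : Fin (n + 1) → ℝ)) ∈ PSet (n + 1) u v ↔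
    (t ∈ Icc 0 v ∧ s ∈ Icc t u) ∧ (p, q) ∈ PSet n s t := by
  simp only [PSet, mem_ofPred_eq, mono_ins, Fin.forall_fin_succ', mem_Icc]
  simp only [Fin.insertNth_last', Fin.snoc_castSucc, Fin.snoc_last]
  constructor
  · rintro ⟨⟨h1, h2⟩, ⟨h3, h4⟩, ⟨h5, h6⟩, ⟨h7, h8⟩, ⟨h9, h10⟩, ⟨h11, h12⟩, h13, h14⟩
    exact ⟨⟨⟨h8, h10⟩, h14, h4⟩, h1, h6, h5, h7, h12, h11, h13⟩
  · rintro ⟨⟨⟨h8, h10⟩, h14, h4⟩, h1, h6, h5, h7, h12, h11, h13⟩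
    exact ⟨⟨h1, h8.trans h14⟩, ⟨fun i => (h6 i).trans h4, h4⟩, ⟨h5, h6⟩, ⟨h7, h8⟩,
      ⟨fun i => (h12 i).trans h10, h10⟩, ⟨h11, h12⟩, h13, h14⟩

lemma L_succ (n : ℕ) (u v : ℝ) :
    L (n + 1) u v = ∫⁻ t in Icc 0 v, ∫⁻ s in Icc t u, L n s t := by
  have hS := measurableSet_PSet (n + 1) u v
  set f : (Fin (n + 1) → ℝ) × (Fin (n + 1) → ℝ) → ENNReal :=
    (PSet (n + 1) u v).indicator 1 with hf
  have hfm : Measurable f := measurable_one.indicator hS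
  have e0 : L (n + 1) u v = ∫⁻ p, ∫⁻ q, f (p, q) := by
    rw [L, ← lintegral_indicator_one hS]
    exact lintegral_prod _ hfm.aemeasurable
  let G : ℝ → (Fin n → ℝ) → ℝ → (Fin n → ℝ) → ENNReal := fun s p t q =>
    f ((Fin.last n).insertNth s p, (Fin.last n).insertNth t q)
  have hG : Measurable fun z : (ℝ × (Fin n → ℝ)) × (ℝ × (Fin n → ℝ)) =>
      G z.1.1 z.1.2 z.2.1 z.2.2 :=
    hfm.comp (((measurable_ins n).comp measurable_fst).prodMk
      ((measurable_ins n).comp measurable_snd))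
  have e1 : L (n + 1) u v = ∫⁻ s, ∫⁻ p, ∫⁻ t, ∫⁻ q, G s p t q := by
    rw [e0, lintegral_snoc _ _ hfm.lintegral_prod_right']
    refine lintegral_congr fun s => lintegral_congr fun p => ?_
    exact lintegral_snoc n (fun q => f ((Fin.last n).insertNth s p, q)) (by fun_prop)
  have e2 : L (n + 1) u v = ∫⁻ s, ∫⁻ t, ∫⁻ p, ∫⁻ q, G s p t q := by
    rw [e1]
    refine lintegral_congr fun s => ?_
    refine lintegral_lintegral_swap (f := fun p t => ∫⁻ q, G s p t q) ?_
    apply Measurable.aemeasurable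
    refine Measurable.lintegral_prod_right'
      (f := fun z : ((Fin n → ℝ) × ℝ) × (Fin n → ℝ) => G s z.1.1 z.1.2 z.2) ?_
    exact hG.comp (g := _) (f := fun z : ((Fin n → ℝ) × ℝ) × (Fin n → ℝ) =>
      ((s, z.1.1), (z.1.2, z.2))) (by fun_prop)
  have e3 : ∀ s t, ∫⁻ p, ∫⁻ q, G s p t q =
      (Icc 0 v).indicator (fun t => (Icc t u).indicator (fun s => L n s t) s) t := by
    intro s t
    have hm := measurableSet_PSet n s t
    by_cases h : t ∈ Icc 0 v ∧ s ∈ Icc t u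
    · rw [indicator_of_mem h.1, indicator_of_mem h.2, L, ← lintegral_indicator_one hm]
      refine Eq.trans ?_ (lintegral_prod _ (measurable_one.indicator hm).aemeasurable).symm
      refine lintegral_congr fun p => lintegral_congr fun q => ?_
      simp only [G, hf]
      have hms := mem_succ n u v s t p q
      by_cases hpq : (p, q) ∈ PSet n s t
      · rw [indicator_of_mem (hms.2 ⟨h, hpq⟩), indicator_of_mem hpq]
        rfl
      · rw [indicator_of_notMem (fun h' => hpq (hms.1 h').2), indicator_of_notMem hpq]
    · have : ∀ p q, G s p t q = 0 := by
        intro p q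
        simp only [G, hf]
        refine indicator_of_notMem ?_ _
        rw [mem_succ]
        exact fun h' => h h'.1
      simp only [this, lintegral_zero]
      by_cases h1 : t ∈ Icc 0 v
      · rw [indicator_of_mem h1, indicator_of_notMem fun h2 => h ⟨h1, h2⟩]
      · rw [indicator_of_notMem h1]
  rw [e2, lintegral_lintegral_swap, ← lintegral_indicator measurableSet_Icc]
  · refine lintegral_congr fun t => ?_
    simp only [e3]
    by_cases h1 : t ∈ Icc 0 v
    · simp only [indicator_of_mem h1]
      rw [lintegral_indicator measurableSet_Icc]
    · simp only [indicator_of_notMem h1, lintegral_zero]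
  · apply Measurable.aemeasurable
    refine Measurable.lintegral_prod_right'
      (f := fun z : (ℝ × ℝ) × (Fin n → ℝ) => ∫⁻ q, G z.1.1 z.2 z.1.2 q) ?_
    refine Measurable.lintegral_prod_right'
      (f := fun z : ((ℝ × ℝ) × (Fin n → ℝ)) × (Fin n → ℝ) => G z.1.1.1 z.1.2 z.1.1.2 z.2) ?_
    exact hG.comp (g := _) (f := fun z : ((ℝ × ℝ) × (Fin n → ℝ)) × (Fin n → ℝ) =>
      ((z.1.1.1, z.1.2), (z.1.1.2, z.2))) (by fun_prop)

lemma L_zero (u v : ℝ) : L 0 u v = 1 := by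
  have : PSet 0 u v = univ := by
    ext p
    simp only [PSet, mem_ofPred_eq, mem_univ, iff_true]
    exact ⟨fun i => i.elim0, fun i => i.elim0, fun i => i.elim0, fun i => i.elim0,
      fun i => i.elim0, fun i => i.elim0, fun i => i.elim0⟩
  rw [L, this, Measure.volume_eq_prod, ← univ_prod_univ, Measure.prod_prod]
  simp [volume_pi]

lemma L_bound (n : ℕ) : ∀ u v : ℝ, 0 ≤ u → 0 ≤ v →
    L n u v ≤ ENNReal.ofReal ((u * v) ^ n / n.factorial) := by
  induction n with
  | zero => intro u v _ _; simp [L_zero]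
  | succ n ih =>
    intro u v hu hv
    rw [L_succ]
    calc ∫⁻ t in Icc 0 v, ∫⁻ s in Icc t u, L n s t
        ≤ ∫⁻ t in Icc 0 v, ENNReal.ofReal (u * ((u * t) ^ n / n.factorial)) := by
          refine setLIntegral_mono (by fun_prop) fun t ht => ?_
          calc ∫⁻ s in Icc t u, L n s t
              ≤ ∫⁻ s in Icc t u, ENNReal.ofReal ((u * t) ^ n / n.factorial) := by
                refine setLIntegral_mono (by fun_prop) fun s hs => ?_
                have h0 := ht.1
                have h1 := h0.trans hs.1
                refine (ih s t h1 h0).trans (ENNReal.ofReal_le_ofReal ?_)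
                have := hs.2
                gcongr
            _ ≤ _ := by
                rw [setLIntegral_const, Real.volume_Icc, mul_comm, ENNReal.ofReal_mul hu]
                gcongr
                linarith [ht.1]
      _ = ENNReal.ofReal (∫ t in Icc 0 v, u * ((u * t) ^ n / n.factorial)) := by
          rw [ofReal_integral_eq_lintegral_ofReal]
          · exact (Continuous.continuousOn (by fun_prop)).integrableOn_compact isCompact_Icc
          · refine (ae_restrict_iff' measurableSet_Icc).2 (ae_of_all _ fun t ht => ?_)
            have := ht.1
            simp only [Pi.zero_apply]
            positivity
      _ = _ := by
          congr 1
          rw [integral_Icc_eq_integral_Ioc, ← intervalIntegral.integral_of_le hv]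
          have : ∀ t : ℝ, u * ((u * t) ^ n / n.factorial) =
              (u ^ (n + 1) / n.factorial) * t ^ n := by intro t; rw [mul_pow]; ring
          simp only [this]
          rw [intervalIntegral.integral_const_mul, integral_pow, Nat.factorial_succ]
          push_cast
          have : (n.factorial : ℝ) ≠ 0 := by positivity
          have : (n + 1 : ℝ) ≠ 0 := by positivity
          field_simp
          ring

/-- The generating sum in extended reals. -/
noncomputable def F (u v : ℝ) : ENNReal := ∑' n, L n u v

lemma measurable_F : Measurable fun z : ℝ × ℝ => F z.1 z.2 :=
  Measurable.ennreal_tsum fun n => measurable_L n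

lemma F_lt_top (u v : ℝ) (hu : 0 ≤ u) (hv : 0 ≤ v) : F u v < ⊤ := by
  refine lt_of_le_of_lt (ENNReal.tsum_le_tsum fun n => L_bound n u v hu hv) ?_
  rw [← ENNReal.ofReal_tsum_of_nonneg]
  · exact ENNReal.ofReal_lt_top
  · intro n; positivity
  · exact Real.summable_pow_div_factorial _

lemma F_eq (u v : ℝ) : F u v = 1 + ∫⁻ t in Icc 0 v, ∫⁻ s in Icc t u, F s t := by
  rw [F, tsum_eq_zero_add' ENNReal.summable, L_zero]
  congr 1
  simp only [L_succ, F]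
  rw [← lintegral_tsum]
  · refine lintegral_congr fun t => ?_
    rw [lintegral_tsum]
    intro n
    exact ((measurable_L n).comp (measurable_id.prodMk measurable_const)).aemeasurable
  · intro n
    apply Measurable.aemeasurable
    have : ∀ t, ∫⁻ s in Icc t u, L n s t = ∫⁻ s, {z : ℝ × ℝ | z.1 ≤ z.2 ∧ z.2 ≤ u}.indicator
        (fun z => L n z.2 z.1) (t, s) := by
      intro t
      rw [← lintegral_indicator measurableSet_Icc]
      rfl
    simp only [this]
    refine Measurable.lintegral_prod_right' (Measurable.indicator ?_ ?_)
    · exact (measurable_L n).comp measurable_swap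
    · exact (measurableSet_le measurable_fst measurable_snd).inter
        (measurableSet_le measurable_snd measurable_const)

lemma measurable_inner (u : ℝ) : Measurable fun t => ∫⁻ s in Icc t u, F s t := by
  have : ∀ t, ∫⁻ s in Icc t u, F s t = ∫⁻ s, {z : ℝ × ℝ | z.1 ≤ z.2 ∧ z.2 ≤ u}.indicator
      (fun z => F z.2 z.1) (t, s) := by
    intro t
    rw [← lintegral_indicator measurableSet_Icc]
    rfl
  simp only [this]
  refine Measurable.lintegral_prod_right' (Measurable.indicator ?_ ?_)
  · exact measurable_F.comp measurable_swap
  · exact (measurableSet_le measurable_fst measurable_snd).inter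
      (measurableSet_le measurable_snd measurable_const)

lemma cat_eq (x y : ℝ) (h1 : 0 ≤ (x + y) / 2) (h2 : 0 ≤ (x - y) / 2) :
    catalanFun2 x y = (F ((x + y) / 2) ((x - y) / 2)).toReal := by
  rw [F, ENNReal.tsum_toReal_eq]
  · rfl
  · intro n
    exact ((L_bound n _ _ h1 h2).trans_lt ENNReal.ofReal_lt_top).ne

end CatAux

open CatAux

/-- the continuous Catalan function satisfies the integral equation
`C(x,y) = 1 + ∫₀^{(x−y)/2} ∫₀^{(x+y)/2−b} C(a+2b,a) da db` for `0 ≤ y ≤ x`. -/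
theorem catalanFun2_integral_equation (x y : ℝ) (hy : 0 ≤ y) (hyx : y ≤ x) :
    catalanFun2 x y =
      1 + ∫ b in (0 : ℝ)..((x - y) / 2),
            ∫ a in (0 : ℝ)..((x + y) / 2 - b), catalanFun2 (a + 2 * b) a := by
  have hu : 0 ≤ (x + y) / 2 := by linarith
  have hv : 0 ≤ (x - y) / 2 := by linarith
  have huv : (x - y) / 2 ≤ (x + y) / 2 := by linarith
  rw [cat_eq x y hu hv]
  generalize (x + y) / 2 = u at *
  generalize (x - y) / 2 = v at *
  have hfin := F_lt_top u v hu hv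
  have hF := F_eq u v
  have hI : ∫⁻ t in Set.Icc 0 v, ∫⁻ s in Set.Icc t u, F s t < ⊤ := by
    refine lt_of_le_of_lt ?_ hfin
    rw [hF]
    exact le_add_self
  rw [hF, ENNReal.toReal_add (by simp) hI.ne, ENNReal.toReal_one,
    ← integral_toReal (measurable_inner u).aemeasurable (ae_lt_top (measurable_inner u) hI.ne),
    integral_Icc_eq_integral_Ioc, intervalIntegral.integral_of_le hv]
  congr 1
  refine setIntegral_congr_fun measurableSet_Ioc fun b hb => ?_
  have hb0 : 0 ≤ b := hb.1.le
  have hbu : b ≤ u := hb.2.trans huv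
  have e : ∫ a in (0 : ℝ)..(u - b), catalanFun2 (a + 2 * b) a =
      ∫ a in (0 : ℝ)..(u - b), (fun s => (F s b).toReal) (a + b) := by
    refine intervalIntegral.integral_congr fun a ha => ?_
    rw [Set.uIcc_of_le (by linarith)] at ha
    have ha0 := ha.1
    have h1 : (a + 2 * b + a) / 2 = a + b := by ring
    have h2 : (a + 2 * b - a) / 2 = b := by ring
    simp only []
    rw [cat_eq _ _ (by linarith) (by linarith), h1, h2]
  rw [e, intervalIntegral.integral_comp_add_right (fun s => (F s b).toReal) b, zero_add, sub_add_cancel,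
    intervalIntegral.integral_of_le hbu, ← integral_Icc_eq_integral_Ioc, integral_toReal]
  · exact (measurable_F.comp (measurable_id.prodMk measurable_const)).aemeasurable
  · refine (ae_restrict_iff' measurableSet_Icc).2 (ae_of_all _ fun s hs => ?_)
    exact F_lt_top s b (hb0.trans hs.1) hb0
end

section
/- For every n ≥ 0, the function I_n is polynomial with expansion I_n(a,b) = ∑_{k,l ≥ 0, k+l ≤ 2n} I^n_{k,l} · a^k b^l/(k!·l!) for all a, b ≥ 0, where the integer coefficients I^n_{k,l} are determined by: I^0_{k,l} = 1 if k = l = 0 and 0 otherwise; I^n_{k,0} = 0 for n > 0; and for l ≥ 1 and n ≥ 1, I^n_{k,l} = ∑_{p=0}^{l−1} ∑_{q=0}^{l−p−1} (−1)^q · C(l,p) · C(l−p−1, q) · I^{n−1}_{k+p+q−1, l−p−q−1}. Moreover I^n_{k,l} = 0 whenever n > l. -/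
/-- The functions `Iₙ : ℝ≥0² → ℝ` defined recursively by `I₀ = 1` and
`Iₙ(a,b) = ∫₀ᵇ ∫₀^{a+b−v} Iₙ₋₁(u,v) du dv`. -/
noncomputable def Ifun : ℕ → ℝ → ℝ → ℝ
  | 0, _, _ => 1
  | n + 1, a, b => ∫ v in (0 : ℝ)..b, ∫ u in (0 : ℝ)..(a + b - v), Ifun n u v

/-- The integer coefficients `Iⁿ_{k,l}` (with value `0` at negative indices),
determined by `I⁰_{k,l} = δ_{k0}δ_{l0}`, `Iⁿ_{k,0} = 0` for `n > 0`, and for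
`l ≥ 1`, `n ≥ 1` the recursion
`Iⁿ_{k,l} = ∑_{p=0}^{l−1} ∑_{q=0}^{l−p−1} (−1)^q C(l,p) C(l−p−1,q) Iⁿ⁻¹_{k+p+q−1, l−p−q−1}`. -/
def Icoef : ℕ → ℤ → ℤ → ℤ
  | 0, k, l => if k = 0 ∧ l = 0 then 1 else 0
  | n + 1, k, l =>
    if 0 ≤ k ∧ 1 ≤ l then
      ∑ p ∈ Finset.range l.toNat, ∑ q ∈ Finset.range (l.toNat - p),
        (-1 : ℤ) ^ q * (Nat.choose l.toNat p) * (Nat.choose (l.toNat - p - 1) q) *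
          Icoef n (k + p + q - 1) (l - p - q - 1)
    else 0

lemma choose_sum_one (l j : ℕ) (h : j < l) :
    ∑ x ∈ Finset.HasAntidiagonal.antidiagonal j,
      (-1 : ℤ) ^ x.2 * (Nat.choose l x.1) * (Nat.choose (l - x.1 - 1) x.2) = 1 := by
  have h1 := Ring.add_choose_eq (R := ℤ) (r := (l : ℤ)) (s := -((l : ℤ) - j)) j (Commute.all _ _)
  rw [show (l : ℤ) + -((l : ℤ) - j) = (j : ℤ) by ring, Ring.choose_natCast, Nat.choose_self] at h1
  rw [Nat.cast_one] at h1
  refine Eq.trans ?_ h1.symm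
  apply Finset.sum_congr rfl
  intro x hx
  rw [Finset.HasAntidiagonal.mem_antidiagonal] at hx
  rw [Ring.choose_natCast, Ring.choose_neg]
  have h2 : ((l : ℤ) - j + (x.2 : ℤ) - 1) = ((l - x.1 - 1 : ℕ) : ℤ) := by omega
  rw [h2, Ring.choose_natCast]
  have h3 : (Int.negOnePow (x.2 : ℤ)) = (-1 : ℤˣ) ^ x.2 := by
    simp [Int.negOnePow]
  rw [h3, Units.smul_def]
  push_cast
  rw [smul_eq_mul]
  ring

lemma Icoef_neg_left (n : ℕ) (k l : ℤ) (h : k < 0) : Icoef n k l = 0 := by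
  cases n with
  | zero => simp [Icoef]; omega
  | succ n => rw [Icoef, if_neg (by omega)]

lemma Icoef_succ (n k l : ℕ) :
    Icoef (n + 1) k (l + 1 : ℕ) =
      ∑ x ∈ Finset.HasAntidiagonal.antidiagonal l, Icoef n ((k : ℤ) + x.1 - 1) x.2 := by
  rw [Icoef, if_pos (by omega), Int.toNat_natCast]
  have h1 : ∀ x ∈ Finset.HasAntidiagonal.antidiagonal l, Icoef n ((k : ℤ) + x.1 - 1) x.2 =
      ∑ y ∈ Finset.HasAntidiagonal.antidiagonal x.1,
      (-1 : ℤ) ^ y.2 * (Nat.choose (l + 1) y.1) * (Nat.choose (l + 1 - y.1 - 1) y.2) *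
        Icoef n ((k : ℤ) + y.1 + y.2 - 1) (((l + 1 : ℕ) : ℤ) - y.1 - y.2 - 1) := by
    intro x hx
    rw [Finset.HasAntidiagonal.mem_antidiagonal] at hx
    have e := congrArg (fun t => t * Icoef n ((k : ℤ) + x.1 - 1) x.2)
      (choose_sum_one (l + 1) x.1 (by omega))
    simp only [one_mul] at e
    rw [← e, Finset.sum_mul]
    apply Finset.sum_congr rfl
    intro y hy
    rw [Finset.HasAntidiagonal.mem_antidiagonal] at hy
    congr 2 <;> omega
  rw [Finset.sum_congr rfl h1, Finset.sum_sigma', Finset.sum_sigma']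
  refine Finset.sum_nbij' (fun z => ⟨(z.1 + z.2, l - z.1 - z.2), (z.1, z.2)⟩)
    (fun z => ⟨z.2.1, z.2.2⟩) ?_ ?_ ?_ ?_ ?_
  · rintro ⟨p, q⟩ hz
    simp at hz ⊢
    omega
  · rintro ⟨⟨j, m⟩, ⟨p, q⟩⟩ hz
    simp at hz ⊢
    omega
  · rintro ⟨p, q⟩ hz
    rfl
  · rintro ⟨⟨j, m⟩, ⟨p, q⟩⟩ hz
    simp at hz ⊢
    obtain ⟨h1, h2⟩ := hz
    omega
  · rintro ⟨p, q⟩ hz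
    rfl

lemma Icoef_zero_right (n : ℕ) (k : ℤ) : Icoef (n + 1) k 0 = 0 := by
  rw [Icoef, if_neg (by omega)]

lemma Icoef_lt (n : ℕ) : ∀ k l : ℕ, l < n → Icoef n k l = 0 := by
  induction n with
  | zero => intro k l h; omega
  | succ n ih =>
    intro k l h
    cases l with
    | zero => exact Icoef_zero_right n k
    | succ l =>
      rw [Icoef_succ]
      apply Finset.sum_eq_zero
      intro x hx
      rw [Finset.HasAntidiagonal.mem_antidiagonal] at hx
      by_cases hk : (k : ℤ) + x.1 - 1 < 0
      · exact Icoef_neg_left _ _ _ hk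
      · have := ih (k + x.1 - 1) x.2 (by omega)
        rw [← this]; congr 1; omega

lemma Icoef_homog (n : ℕ) : ∀ k l : ℕ, k + l ≠ 2 * n → Icoef n k l = 0 := by
  induction n with
  | zero => intro k l h; simp [Icoef]; omega
  | succ n ih =>
    intro k l h
    cases l with
    | zero => exact Icoef_zero_right n k
    | succ l =>
      rw [Icoef_succ]
      apply Finset.sum_eq_zero
      intro x hx
      rw [Finset.HasAntidiagonal.mem_antidiagonal] at hx
      by_cases hk : (k : ℤ) + x.1 - 1 < 0
      · exact Icoef_neg_left _ _ _ hk
      · have := ih (k + x.1 - 1) x.2 (by omega)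
        rw [← this]; congr 1; omega

/-- Divided power. -/
noncomputable def dpw (x : ℝ) (k : ℕ) : ℝ := x ^ k / (Nat.factorial k : ℝ)

lemma dpw_hasDerivAt (x : ℝ) (k : ℕ) : HasDerivAt (fun y => dpw y (k + 1)) (dpw x k) x := by
  unfold dpw
  have h := (hasDerivAt_pow (k + 1) x).div_const ((Nat.factorial (k + 1) : ℕ) : ℝ)
  refine h.congr_deriv ?_
  have h1 : (Nat.factorial k : ℝ) ≠ 0 := by positivity
  have h2 : (k : ℝ) + 1 ≠ 0 := by positivity
  rw [Nat.factorial_succ]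
  push_cast
  field_simp

lemma dpw_cont (k : ℕ) : Continuous (fun y => dpw y k) := by
  unfold dpw
  fun_prop

lemma dpw_zero (x : ℝ) : dpw x 0 = 1 := by simp [dpw]

lemma dpw_zero_succ (k : ℕ) : dpw 0 (k + 1) = 0 := by simp [dpw]

lemma dpw_integral (x : ℝ) (k : ℕ) : ∫ u in (0 : ℝ)..x, dpw u k = dpw x (k + 1) := by
  rw [intervalIntegral.integral_eq_sub_of_hasDerivAt (fun y _ => dpw_hasDerivAt y k)
    ((dpw_cont k).intervalIntegrable _ _), dpw_zero_succ, sub_zero]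

lemma dpw_add (x y : ℝ) (n : ℕ) :
    dpw (x + y) n = ∑ p ∈ Finset.HasAntidiagonal.antidiagonal n, dpw x p.1 * dpw y p.2 := by
  unfold dpw
  rw [(Commute.all x y).add_pow', Finset.sum_div]
  apply Finset.sum_congr rfl
  rintro ⟨i, j⟩ h
  rw [Finset.HasAntidiagonal.mem_antidiagonal] at h
  dsimp only at h ⊢
  subst h
  have h0 := Nat.choose_mul_factorial_mul_factorial (Nat.le_add_right i j)
  rw [Nat.add_sub_cancel_left] at h0
  have h0' : (((i + j).choose i : ℕ) : ℝ) * (Nat.factorial i : ℝ) * (Nat.factorial j : ℝ) =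
    (Nat.factorial (i + j) : ℝ) := by exact_mod_cast h0
  have h1 : (Nat.factorial i : ℝ) ≠ 0 := by positivity
  have h2 : (Nat.factorial j : ℝ) ≠ 0 := by positivity
  have h3 : (Nat.factorial (i + j) : ℝ) ≠ 0 := by positivity
  rw [nsmul_eq_mul]
  field_simp
  rw [← h0']
  ring

lemma hasDerivAt_shift (a b v : ℝ) (K : ℕ) :
    HasDerivAt (fun v => - dpw (a + b - v) (K + 1)) (dpw (a + b - v) K) v := by
  have h1 : HasDerivAt (fun v : ℝ => a + b - v) (-1) v := by
    simpa using (hasDerivAt_id v).const_sub (a + b)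
  have h := ((dpw_hasDerivAt (a + b - v) K).comp v h1).neg
  refine h.congr_deriv ?_
  ring

lemma shift_cont (a b : ℝ) (K : ℕ) : Continuous (fun v => dpw (a + b - v) K) :=
  (dpw_cont K).comp (by fun_prop)

lemma conv_integral (a b : ℝ) (l : ℕ) : ∀ K : ℕ,
    ∫ v in (0 : ℝ)..b, dpw (a + b - v) K * dpw v l =
      ∑ p ∈ Finset.HasAntidiagonal.antidiagonal K, dpw a p.1 * dpw b (p.2 + l + 1) := by
  induction l with
  | zero =>
    intro K
    simp only [dpw_zero, mul_one, add_zero]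
    rw [intervalIntegral.integral_eq_sub_of_hasDerivAt (fun v _ => hasDerivAt_shift a b v K)
      ((shift_cont a b K).intervalIntegrable _ _)]
    rw [sub_zero, add_sub_cancel_right, dpw_add, Finset.Nat.sum_antidiagonal_succ', dpw_zero]
    ring
  | succ l ih =>
    intro K
    have h := intervalIntegral.integral_mul_deriv_eq_deriv_mul (a := 0) (b := b)
      (u := fun v => dpw v (l + 1)) (v := fun v => - dpw (a + b - v) (K + 1))
      (u' := fun v => dpw v l) (v' := fun v => dpw (a + b - v) K)
      (fun v _ => dpw_hasDerivAt v l) (fun v _ => hasDerivAt_shift a b v K)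
      ((dpw_cont l).intervalIntegrable _ _) ((shift_cont a b K).intervalIntegrable _ _)
    have h2 := ih (K + 1)
    have e : ∀ v, dpw v l * - dpw (a + b - v) (K + 1) = - (dpw (a + b - v) (K + 1) * dpw v l) := by
      intro v; ring
    simp only [e, intervalIntegral.integral_neg, h2, dpw_zero_succ, add_sub_cancel_right] at h
    simp only [mul_comm (dpw (a + b - _) K)]
    rw [h, Finset.Nat.sum_antidiagonal_succ']
    simp only [zero_add, add_assoc, add_comm, add_left_comm]
    ring

lemma Ifun_hom (n : ℕ) : ∀ a b : ℝ, Ifun n a b =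
    ∑ p ∈ Finset.HasAntidiagonal.antidiagonal (2 * n), (Icoef n p.1 p.2 : ℝ) * (dpw a p.1 * dpw b p.2) := by
  induction n with
  | zero => intro a b; simp [Ifun, Icoef, dpw_zero]
  | succ n ih =>
    intro a b
    have hin : ∀ v : ℝ, ∫ u in (0 : ℝ)..(a + b - v), Ifun n u v =
        ∑ p ∈ Finset.HasAntidiagonal.antidiagonal (2 * n),
          (Icoef n p.1 p.2 : ℝ) * (dpw (a + b - v) (p.1 + 1) * dpw v p.2) := by
      intro v
      simp only [ih]
      rw [intervalIntegral.integral_finsetSum]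
      · apply Finset.sum_congr rfl
        intro p _
        rw [intervalIntegral.integral_const_mul, intervalIntegral.integral_mul_const, dpw_integral]
      · intro p _
        exact (((dpw_cont p.1).mul continuous_const).const_mul _).intervalIntegrable _ _
    rw [Ifun]
    simp only [hin]
    rw [intervalIntegral.integral_finsetSum]
    swap
    · intro p _
      exact (((shift_cont a b _).mul (dpw_cont p.2)).const_mul _).intervalIntegrable _ _
    simp only [intervalIntegral.integral_const_mul, conv_integral]
    rw [show 2 * (n + 1) = (2 * n + 1) + 1 by ring, Finset.Nat.sum_antidiagonal_succ']
    simp only [Nat.cast_zero, Icoef_zero_right, Int.cast_zero, zero_mul, zero_add, Icoef_succ,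
      Int.cast_sum, Finset.sum_mul]
    have hl : ∑ p ∈ Finset.HasAntidiagonal.antidiagonal (2 * n), (Icoef n p.1 p.2 : ℝ) *
          ∑ x ∈ Finset.HasAntidiagonal.antidiagonal (p.1 + 1), dpw a x.1 * dpw b (x.2 + p.2 + 1) =
        ∑ p ∈ Finset.HasAntidiagonal.antidiagonal (2 * n + 1), (Icoef n ((p.1 : ℤ) - 1) p.2 : ℝ) *
          ∑ x ∈ Finset.HasAntidiagonal.antidiagonal p.1, dpw a x.1 * dpw b (x.2 + p.2 + 1) := by
      rw [Finset.Nat.sum_antidiagonal_succ]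
      rw [Icoef_neg_left n _ _ (by simp)]
      simp
    rw [hl]
    simp only [Finset.mul_sum]
    rw [Finset.sum_sigma', Finset.sum_sigma']
    refine Finset.sum_nbij' (fun z => ⟨(z.2.1, z.2.2 + z.1.2), (z.2.2, z.1.2)⟩)
      (fun z => ⟨(z.1.1 + z.2.1, z.2.2), (z.1.1, z.2.1)⟩) ?_ ?_ ?_ ?_ ?_
    · rintro ⟨⟨K, l⟩, ⟨k, j⟩⟩ hz
      simp at hz ⊢
      omega
    · rintro ⟨⟨K, l⟩, ⟨k, j⟩⟩ hz
      simp at hz ⊢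
      omega
    · rintro ⟨⟨K, l⟩, ⟨k, j⟩⟩ hz
      simp at hz ⊢
      obtain ⟨h1, h2⟩ := hz
      exact h2
    · rintro ⟨⟨K, l⟩, ⟨k, j⟩⟩ hz
      simp at hz ⊢
      obtain ⟨h1, h2⟩ := hz
      exact h2
    · rintro ⟨⟨K, l⟩, ⟨k, j⟩⟩ hz
      simp at hz ⊢
      obtain ⟨h1, h2⟩ := hz
      subst h2
      push_cast
      simp

/-- each `Iₙ` is a polynomial function on `ℝ≥0²` with expansion
`Iₙ(a,b) = ∑_{k+l ≤ 2n} Iⁿ_{k,l} aᵏ bˡ/(k! l!)`, and `Iⁿ_{k,l} = 0` whenever `n > l`. -/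
theorem Ifun_expansion (n : ℕ) :
    (∀ a b : ℝ, 0 ≤ a → 0 ≤ b →
      Ifun n a b =
        ∑ k ∈ Finset.range (2 * n + 1), ∑ l ∈ Finset.range (2 * n + 1 - k),
          (Icoef n k l : ℝ) * a ^ k * b ^ l /
            ((Nat.factorial k : ℝ) * (Nat.factorial l : ℝ))) ∧
    (∀ k l : ℕ, l < n → Icoef n k l = 0) := by
  refine ⟨?_, Icoef_lt n⟩
  intro a b _ _
  rw [Ifun_hom, Finset.Nat.sum_antidiagonal_eq_sum_range_succ_mk]
  apply Finset.sum_congr rfl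
  intro k hk
  rw [Finset.mem_range] at hk
  dsimp only
  rw [Finset.sum_eq_single_of_mem (2 * n - k) (by rw [Finset.mem_range]; omega)]
  · unfold dpw
    field_simp
  · intro l hl hne
    rw [Finset.mem_range] at hl
    rw [Icoef_homog n k l (by omega)]
    simp
end

section
/- For every real x ≥ 0, the one-variable continuous Catalan function at 2x is given by C(2x) = ∑_{n=0}^∞ vol(Λ^n(2x, 0)) = 1 + ∑_{m=2}^∞ [ ∑_{k+l = m−2} ( ∑_{n=1}^{l+1} I^{n−1}_{k,l} ) · ∑_{p=0}^{k+1} (−1)^{k+1−p} · C(m,p) · C(m−p−1, l) ] · x^m/m!. -/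
open MeasureTheory

/-- The one-variable continuous Catalan function `C(x) = ∑ₙ vol(Λⁿ(x,0))`. -/
noncomputable def catalanFun (x : ℝ) : ℝ := ∑' n : ℕ, lambdaVol n x 0

lemma ccf_vander (M s : ℕ) (h : s ≤ M) :
    ∑ p ∈ Finset.range (s + 1),
      (-1 : ℤ) ^ (s - p) * (Nat.choose (M + 1) p : ℤ) * (Nat.choose (M - p) (s - p) : ℤ) = 1 := by
  have h1 := Ring.add_choose_eq (R := ℤ) (r := ((M + 1 : ℕ) : ℤ)) (s := (s : ℤ) - (M + 1 : ℕ)) s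
    (Commute.all _ _)
  rw [show ((M + 1 : ℕ) : ℤ) + ((s : ℤ) - (M + 1 : ℕ)) = (s : ℕ) by ring,
    Ring.choose_natCast, Nat.choose_self, Finset.Nat.sum_antidiagonal_eq_sum_range_succ_mk] at h1
  refine Eq.trans ?_ (h1.symm.trans Nat.cast_one)
  refine Finset.sum_congr rfl fun p hp => ?_
  have hp' : p ≤ s := by simpa [Nat.lt_succ_iff] using hp
  have h2 : Ring.choose ((s : ℤ) - (M + 1 : ℕ)) (s - p) =
      (-1) ^ (s - p) * (Nat.choose (M - p) (s - p) : ℤ) := by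
    have := Ring.choose_neg' (R := ℤ) ((M + 1 : ℕ) - (s : ℤ)) (s - p)
    rw [neg_sub] at this
    rw [this, Ring.multichoose_eq, show ((M + 1 : ℕ) : ℤ) - s + (s - p : ℕ) - 1 = (M - p : ℕ) by
      omega, Ring.choose_natCast]
    simp [Int.negOnePow_def, Units.smul_def]
  simp only [h2, Ring.choose_natCast]
  ring

lemma ccf_Icoef_zero (n : ℕ) : ∀ k l : ℤ, k + l ≠ 2 * n → Icoef n k l = 0 := by
  induction n with
  | zero =>
    intro k l h
    simp only [Icoef]
    rw [if_neg]
    rintro ⟨rfl, rfl⟩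
    simp at h
  | succ n ih =>
    intro k l h
    simp only [Icoef]
    split_ifs with h0
    · refine Finset.sum_eq_zero fun p _ => Finset.sum_eq_zero fun q _ => ?_
      rw [ih, mul_zero]
      push_cast at h
      intro h'
      apply h
      linarith
    · rfl

lemma ccf_Icoef_neg (n : ℕ) (k l : ℤ) (hk : k < 0) : Icoef n k l = 0 := by
  cases n <;> simp only [Icoef] <;> rw [if_neg] <;> omega

lemma ccf_Icoef_succ (n l : ℕ) (h : l ≤ 2 * n + 2) :
    Icoef (n + 1) (2 * n + 2 - l) l = ∑ r ∈ Finset.range l, Icoef n (2 * n - r) r := by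
  rcases Nat.eq_zero_or_pos l with rfl | hl
  · simp [Icoef]
  simp only [Icoef]
  rw [if_pos (by omega), Int.toNat_natCast,
    ← Finset.sum_range_diag_flip l (fun p q => (-1 : ℤ) ^ q * (Nat.choose l p) *
      (Nat.choose (l - p - 1) q) * Icoef n (2 * n + 2 - l + p + q - 1) (l - p - q - 1)),
    ← Finset.sum_range_reflect]
  refine Finset.sum_congr rfl fun r hr => ?_
  have hr' : r < l := by simpa using hr
  have hv := ccf_vander (l - 1) (l - 1 - r) (by omega)
  refine Eq.trans ?_ ((congrArg (fun z => z * Icoef n (2 * n - r) r) hv).trans (one_mul _))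
  simp only [Finset.sum_mul]
  refine Finset.sum_congr rfl fun p hp => ?_
  have hp' : p ≤ l - 1 - r := by simpa [Nat.lt_succ_iff] using hp
  rw [show l - 1 + 1 = l by omega, show l - 1 - p = l - p - 1 by omega]
  congr 2 <;> omega

lemma ccf_hockey (n l : ℕ) : ∑ r ∈ Finset.range l, ((Nat.choose r n : ℤ) - Nat.choose r (n + 1)) =
    Nat.choose l (n + 1) - Nat.choose l (n + 2) := by
  induction l with
  | zero => simp
  | succ l ih =>
    rw [Finset.sum_range_succ, ih, Nat.choose_succ_succ l n, Nat.choose_succ_succ l (n + 1)]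
    push_cast
    ring

lemma ccf_Icoef_closed (n : ℕ) : ∀ l : ℕ, l ≤ 2 * n + 1 →
    Icoef n (2 * n - l) l = (Nat.choose l n : ℤ) - Nat.choose l (n + 1) := by
  induction n with
  | zero =>
    intro l hl
    have : l = 0 ∨ l = 1 := by omega
    rcases this with rfl | rfl <;> simp [Icoef]
  | succ n ih =>
    intro l hl
    by_cases h : l = 2 * n + 3
    · subst h
      rw [ccf_Icoef_neg _ _ _ (by push_cast; omega)]
      rw [Nat.choose_symm_of_eq_add (show 2 * n + 3 = (n + 1) + (n + 1 + 1) by ring)]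
      ring
    · rw [show (2 * ((n + 1 : ℕ) : ℤ) - l) = 2 * n + 2 - l by push_cast; ring,
        ccf_Icoef_succ n l (by omega), ← ccf_hockey]
      refine Finset.sum_congr rfl fun r hr => ih r ?_
      have : r < l := by simpa using hr
      omega

lemma ccf_sum (N : ℕ) : ∑ k ∈ Finset.range (2 * N + 1), Icoef N k (2 * N - k) =
    Nat.choose (2 * N + 1) (N + 1) - Nat.choose (2 * N + 1) (N + 2) := by
  rw [← ccf_hockey, ← Finset.sum_range_reflect]
  refine Finset.sum_congr rfl fun r hr => ?_
  have hr' : r < 2 * N + 1 := by simpa using hr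
  rw [← ccf_Icoef_closed N r (by omega)]
  congr 1 <;> omega

lemma ccf_Icoef_big (n : ℕ) (l : ℕ) (h : l < n) : ∀ k : ℤ, Icoef n k l = 0 := by
  intro k
  by_cases hk : k + l = 2 * n
  · rw [show k = 2 * n - l by omega, ccf_Icoef_closed n l (by omega),
      Nat.choose_eq_zero_of_lt h, Nat.choose_eq_zero_of_lt (by omega)]
    simp
  · exact ccf_Icoef_zero n k l hk

lemma ccf_S (j k : ℕ) (hk : k ≤ j) : ∑ p ∈ Finset.range (k + 2),
      (-1 : ℝ) ^ (k + 1 - p) * (Nat.choose (j + 2) p : ℝ) * (Nat.choose (j + 1 - p) (j - k) : ℝ)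
      = 1 := by
  have := ccf_vander (j + 1) (k + 1) (by omega)
  have h2 := congrArg (Int.cast : ℤ → ℝ) this
  push_cast at h2
  refine Eq.trans ?_ h2
  refine Finset.sum_congr rfl fun p hp => ?_
  have hp' : p ≤ k + 1 := by simpa [Nat.lt_succ_iff] using hp
  rw [Nat.choose_symm_of_eq_add (show j + 1 - p = (j - k) + (k + 1 - p) by omega)]

/-- the coefficient of `x ^ (j+2) / (j+2)!` -/
noncomputable def ccfCoef (j : ℕ) : ℝ := ∑ k ∈ Finset.range (j + 1),
          ((∑ n ∈ Finset.range (j - k + 1), (Icoef n k (j - k) : ℝ)) *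
            ∑ p ∈ Finset.range (k + 2),
              (-1 : ℝ) ^ (k + 1 - p) * (Nat.choose (j + 2) p : ℝ) *
                (Nat.choose (j + 1 - p) (j - k) : ℝ))

lemma ccf_coef_odd (j : ℕ) (h : ¬ Even j) : ccfCoef j = 0 := by
  refine Finset.sum_eq_zero fun k _ => ?_
  rw [Finset.sum_eq_zero, zero_mul]
  intro n _
  rw [ccf_Icoef_zero, Int.cast_zero]
  intro h'
  apply h
  exact ⟨n, by omega⟩

lemma ccf_coef_even (N : ℕ) : ccfCoef (2 * N) =
    (Nat.choose (2 * N + 1) (N + 1) : ℝ) - Nat.choose (2 * N + 1) (N + 2) := by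
  have h := congrArg (Int.cast : ℤ → ℝ) (ccf_sum N)
  push_cast at h
  rw [← h, ccfCoef]
  refine Finset.sum_congr rfl fun k hk => ?_
  have hk' : k ≤ 2 * N := by simpa [Nat.lt_succ_iff] using hk
  rw [ccf_S _ _ hk', mul_one]
  by_cases hN : N ≤ 2 * N - k
  · rw [Finset.sum_eq_single N]
    · push_cast; rfl
    · intro n _ hn
      rw [ccf_Icoef_zero, Int.cast_zero]
      push_cast
      omega
    · intro h
      simp at h
      omega
  · have e : (((2 * N : ℕ) : ℤ) - (k : ℤ)) = ((2 * N - k : ℕ) : ℤ) := by omega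
    have e' : ((2 * (N : ℤ)) - (k : ℤ)) = ((2 * N - k : ℕ) : ℤ) := by omega
    rw [e', ccf_Icoef_big N _ (by omega), Int.cast_zero]
    refine Finset.sum_eq_zero fun n hn => ?_
    simp only [Finset.mem_range] at hn
    rw [ccf_Icoef_zero, Int.cast_zero]
    push_cast
    omega

lemma ccf_cat (N : ℕ) : ((Nat.choose (2 * N + 1) (N + 1) : ℝ) - Nat.choose (2 * N + 1) (N + 2)) /
    (Nat.factorial (2 * N + 2) : ℝ) = 1 / ((Nat.factorial (N + 1) : ℝ) * Nat.factorial (N + 2)) := by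
  have h1 : (Nat.choose (2 * N + 1) (N + 2) : ℝ) * (N + 2) = Nat.choose (2 * N + 1) (N + 1) * N := by
    have := Nat.choose_succ_right_eq (2 * N + 1) (N + 1)
    rw [show 2 * N + 1 - (N + 1) = N by omega] at this
    exact_mod_cast this
  have h2 : (Nat.choose (2 * N + 1) (N + 1) : ℝ) * Nat.factorial (N + 1) * Nat.factorial N =
      Nat.factorial (2 * N + 1) := by
    have := Nat.choose_mul_factorial_mul_factorial (show N + 1 ≤ 2 * N + 1 by omega)
    rw [show 2 * N + 1 - (N + 1) = N by omega] at this
    exact_mod_cast this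
  have h3 : (Nat.choose (2 * N + 1) (N + 2) : ℝ) =
      Nat.choose (2 * N + 1) (N + 1) * N / (N + 2) := by
    rw [eq_div_iff (by positivity)]; exact h1
  rw [h3, Nat.factorial_succ (2 * N + 1), Nat.factorial_succ (N + 1)]
  push_cast
  rw [← h2, Nat.factorial_succ N]
  have : (Nat.choose (2 * N + 1) (N + 1) : ℝ) ≠ 0 := by
    exact_mod_cast (Nat.choose_pos (by omega)).ne'
  have := Nat.factorial_ne_zero N
  push_cast
  field_simp
  ring
/-- auxiliary form of `LambdaSet` -/
def ccfL (n : ℕ) (a b : ℝ) : Set ((Fin n → ℝ) × (Fin n → ℝ)) :=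
  {p | (∀ i, 0 ≤ p.1 i) ∧ (∀ i, p.1 i ≤ a) ∧ Monotone p.1 ∧
       (∀ i, 0 ≤ p.2 i) ∧ (∀ i, p.2 i ≤ b) ∧ Monotone p.2 ∧
       (∀ i, p.2 i ≤ p.1 i)}

/-- closed form of the volume -/
noncomputable def ccfV (n : ℕ) (a b : ℝ) : ℝ :=
  a ^ n * b ^ n / (n.factorial * n.factorial) -
    n * a ^ (n - 1) * b ^ (n + 1) / (n.factorial * (n + 1).factorial)

/-- closed form of the inner integral -/
noncomputable def ccfW (n : ℕ) (a t : ℝ) : ℝ :=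
  (a ^ (n + 1) * t ^ n - a ^ n * t ^ (n + 1)) / (n.factorial * (n + 1).factorial)

/-- the slicing region -/
def ccfT (n : ℕ) (a b : ℝ) : Set ((ℝ × ℝ) × ((Fin n → ℝ) × (Fin n → ℝ))) :=
  {z | 0 ≤ z.1.1 ∧ z.1.1 ≤ a ∧ 0 ≤ z.1.2 ∧ z.1.2 ≤ b ∧ z.1.2 ≤ z.1.1 ∧
    z.2 ∈ ccfL n z.1.1 z.1.2}

lemma ccfT_closed (n : ℕ) (a b : ℝ) : IsClosed (ccfT n a b) := by
  simp only [ccfT, ccfL, Set.mem_ofPred_eq, Monotone]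
  simp only [Set.ofPred_and, Set.ofPred_forall]
  repeat' first
    | apply IsClosed.inter
    | (apply isClosed_iInter; intro _)
    | exact isClosed_le (by fun_prop) (by fun_prop)

lemma ccf_shuffle {α β γ δ : Type*} [MeasureSpace α] [MeasureSpace β] [MeasureSpace γ]
    [MeasureSpace δ] [SigmaFinite (volume : Measure α)] [SigmaFinite (volume : Measure β)]
    [SigmaFinite (volume : Measure γ)] [SigmaFinite (volume : Measure δ)] :
    MeasurePreserving (fun p : (α × β) × (γ × δ) => ((p.1.1, p.2.1), (p.1.2, p.2.2)))
      volume volume := by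
  have h1 := measurePreserving_prodAssoc (volume : Measure α) (volume : Measure β)
    (volume : Measure (γ × δ))
  have h2 := (MeasurePreserving.id (volume : Measure α)).prod
    ((measurePreserving_prodAssoc (volume : Measure β) (volume : Measure γ)
    (volume : Measure δ)).symm)
  have h3 := (MeasurePreserving.id (volume : Measure α)).prod
    ((Measure.measurePreserving_swap (μ := (volume : Measure β)) (ν := (volume : Measure γ))).prod
      (MeasurePreserving.id (volume : Measure δ)))
  have h4 := (MeasurePreserving.id (volume : Measure α)).prod
    (measurePreserving_prodAssoc (volume : Measure γ) (volume : Measure β)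
    (volume : Measure δ))
  have h5 := (measurePreserving_prodAssoc (volume : Measure α) (volume : Measure γ)
    (volume : Measure (β × δ))).symm
  exact h5.comp (h4.comp (h3.comp (h2.comp h1)))

lemma ccf_slice (n : ℕ) : MeasurePreserving
    (fun p : (Fin (n + 1) → ℝ) × (Fin (n + 1) → ℝ) =>
      (((p.1 (Fin.last n), p.2 (Fin.last n)),
        ((fun i => p.1 i.castSucc), (fun i => p.2 i.castSucc))) :
        (ℝ × ℝ) × ((Fin n → ℝ) × (Fin n → ℝ)))) volume volume := by
  have h := volume_preserving_piFinSuccAbove (fun _ : Fin (n + 1) => ℝ) (Fin.last n)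
  have h2 := (ccf_shuffle (α := ℝ) (β := Fin n → ℝ) (γ := ℝ) (δ := Fin n → ℝ)).comp (h.prod h)
  refine Eq.mp (congrArg (fun g => MeasurePreserving g _ _) ?_) h2
  funext p
  refine Prod.ext rfl (Prod.ext ?_ ?_) <;>
    (funext i; simp [MeasurableEquiv.piFinSuccAbove, Fin.insertNthEquiv, Fin.init])

lemma ccf_mono_iff (n : ℕ) (f : Fin (n + 1) → ℝ) : Monotone f ↔
    Monotone (fun i : Fin n => f i.castSucc) ∧ ∀ i : Fin n, f i.castSucc ≤ f (Fin.last n) := by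
  constructor
  · intro h
    exact ⟨fun i j hij => h (by simpa using hij), fun i => h (Fin.le_last _)⟩
  · rintro ⟨h1, h2⟩ i j hij
    induction j using Fin.lastCases with
    | last =>
      induction i using Fin.lastCases with
      | last => rfl
      | cast i => exact h2 i
    | cast j =>
      induction i using Fin.lastCases with
      | last => exact absurd hij (by simp)
      | cast i => exact h1 (by simpa using hij)

lemma ccf_preimage (n : ℕ) (a b : ℝ) : ccfL (n + 1) a b =
    (fun p : (Fin (n + 1) → ℝ) × (Fin (n + 1) → ℝ) =>
      (((p.1 (Fin.last n), p.2 (Fin.last n)),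
        ((fun i => p.1 i.castSucc), (fun i => p.2 i.castSucc))) :
        (ℝ × ℝ) × ((Fin n → ℝ) × (Fin n → ℝ)))) ⁻¹' ccfT n a b := by
  ext p
  simp only [ccfL, ccfT, Set.mem_ofPred_eq, Set.mem_preimage, ccf_mono_iff n, Fin.forall_fin_succ']
  constructor
  · rintro ⟨⟨h1, h2⟩, ⟨h3, h4⟩, ⟨h5, h6⟩, ⟨h7, h8⟩, ⟨h9, h10⟩, ⟨h11, h12⟩, h13, h14⟩
    exact ⟨h2, h4, h8, h10, h14, h1, h6, h5, h7, h12, h11, h13⟩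
  · rintro ⟨h2, h4, h8, h10, h14, h1, h6, h5, h7, h12, h11, h13⟩
    exact ⟨⟨h1, h2⟩, ⟨fun i => (h6 i).trans h4, h4⟩, ⟨h5, h6⟩, ⟨h7, h8⟩,
      ⟨fun i => (h12 i).trans h10, h10⟩, ⟨h11, h12⟩, h13, h14⟩

lemma ccf_ftc (F f : ℝ → ℝ) (c d : ℝ) (hcd : c ≤ d) (hF : ∀ x, HasDerivAt F (f x) x)
    (hf : Continuous f) (h0 : ∀ x, c ≤ x → x ≤ d → 0 ≤ f x) :
    ∫⁻ s in Set.Icc c d, ENNReal.ofReal (f s) = ENNReal.ofReal (F d - F c) := by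
  rw [← ofReal_integral_eq_lintegral_ofReal, integral_Icc_eq_integral_Ioc,
    ← intervalIntegral.integral_of_le hcd,
    intervalIntegral.integral_eq_sub_of_hasDerivAt (fun x _ => hF x) (hf.intervalIntegrable _ _)]
  · exact hf.continuousOn.integrableOn_Icc
  · exact (ae_restrict_iff' measurableSet_Icc).2 (Filter.Eventually.of_forall
      fun x hx => h0 x hx.1 hx.2)

lemma ccfV_nonneg (n : ℕ) (a b : ℝ) (hb : 0 ≤ b) (hab : b ≤ a) : 0 ≤ ccfV n a b := by
  have ha : 0 ≤ a := hb.trans hab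
  cases n with
  | zero => simp [ccfV]
  | succ n =>
    have : ccfV (n + 1) a b = a ^ n * b ^ (n + 1) * (a + (n + 1) * (a - b)) /
        ((n + 1).factorial * (n + 2).factorial) := by
      rw [ccfV, Nat.factorial_succ (n + 1)]
      have := Nat.factorial_ne_zero (n + 1)
      push_cast
      try simp only [add_tsub_cancel_right]
      field_simp
      ring
    rw [this]
    have : 0 ≤ a - b := by linarith
    positivity

lemma ccfW_nonneg (n : ℕ) (a b : ℝ) (hb : 0 ≤ b) (hab : b ≤ a) : 0 ≤ ccfW n a b := by
  have ha : 0 ≤ a := hb.trans hab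
  have : ccfW n a b = a ^ n * b ^ n * (a - b) / (n.factorial * (n + 1).factorial) := by
    rw [ccfW]; ring
  rw [this]
  have : 0 ≤ a - b := by linarith
  positivity

lemma ccf_inner (n : ℕ) (a t : ℝ) (ht : 0 ≤ t) (hta : t ≤ a) :
    ∫⁻ s in Set.Icc t a, ENNReal.ofReal (ccfV n s t) = ENNReal.ofReal (ccfW n a t) := by
  rw [ccf_ftc (fun s => ccfW n s t) (fun s => ccfV n s t) t a hta]
  · congr 1
    simp only [ccfW]
    ring
  · intro s
    have h := (((hasDerivAt_pow (n + 1) s).mul_const (t ^ n)).sub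
      ((hasDerivAt_pow n s).mul_const (t ^ (n + 1)))).div_const
        ((n.factorial : ℝ) * (n + 1).factorial)
    refine h.congr_deriv ?_
    rw [ccfV, Nat.factorial_succ n]
    have := Nat.factorial_ne_zero n
    push_cast
    try simp only [add_tsub_cancel_right]
    field_simp
  · unfold ccfV; fun_prop
  · exact fun s h1 _ => ccfV_nonneg n s t ht h1

lemma ccf_outer (n : ℕ) (a b : ℝ) (hb : 0 ≤ b) (hba : b ≤ a) :
    ∫⁻ t in Set.Icc 0 b, ENNReal.ofReal (ccfW n a t) = ENNReal.ofReal (ccfV (n + 1) a b) := by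
  rw [ccf_ftc (fun t => ccfV (n + 1) a t) (fun t => ccfW n a t) 0 b hb]
  · congr 1
    simp [ccfV]
  · intro t
    have h := (((hasDerivAt_pow (n + 1) t).const_mul (a ^ (n + 1))).div_const
        (((n + 1).factorial : ℝ) * (n + 1).factorial)).sub
      (((hasDerivAt_pow (n + 2) t).const_mul (((n + 1 : ℕ) : ℝ) * a ^ n)).div_const
        (((n + 1).factorial : ℝ) * (n + 1 + 1).factorial))
    refine h.congr_deriv ?_
    rw [ccfW, Nat.factorial_succ (n + 1), Nat.factorial_succ n]
    have := Nat.factorial_ne_zero n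
    push_cast
    try simp only [add_tsub_cancel_right, show n + 2 - 1 = n + 1 by omega]
    field_simp
    ring
  · unfold ccfW; fun_prop
  · exact fun s h1 h2 => ccfW_nonneg n a s h1 (h2.trans hba)

lemma ccf_vol (n : ℕ) : ∀ a b : ℝ, 0 ≤ b → b ≤ a →
    volume (ccfL n a b) = ENNReal.ofReal (ccfV n a b) := by
  induction n with
  | zero =>
    intro a b _ _
    have : ccfL 0 a b = Set.univ ×ˢ Set.univ := by
      ext p
      simp [ccfL, Subsingleton.monotone]
    rw [this, Measure.volume_eq_prod, Measure.prod_prod]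
    simp [ccfV, volume_pi]
  | succ n ih =>
    intro a b hb hba
    have hT := (ccfT_closed n a b).measurableSet
    rw [ccf_preimage, (ccf_slice n).measure_preimage hT.nullMeasurableSet,
      Measure.volume_eq_prod, Measure.prod_apply hT, Measure.volume_eq_prod,
      lintegral_prod_symm _ (measurable_measure_prodMk_left hT).aemeasurable,
      ← ccf_outer n a b hb hba, ← lintegral_indicator measurableSet_Icc]
    refine lintegral_congr fun t => ?_
    by_cases ht : t ∈ Set.Icc 0 b
    · rw [Set.indicator_of_mem ht, ← ccf_inner n a t ht.1 (ht.2.trans hba),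
        ← lintegral_indicator measurableSet_Icc]
      refine lintegral_congr fun s => ?_
      by_cases hs : s ∈ Set.Icc t a
      · rw [Set.indicator_of_mem hs, ← ih s t ht.1 hs.1]
        congr 1
        ext z
        simp [ccfT, ht.1, ht.2, hs.1, hs.2, ht.1.trans hs.1]
      · rw [Set.indicator_of_notMem hs]
        convert measure_empty (μ := (volume : Measure ((Fin n → ℝ) × (Fin n → ℝ)))) using 2
        ext z
        simp only [ccfT, Set.mem_preimage, Set.mem_ofPred_eq, Set.mem_empty_iff_false, iff_false]
        rintro ⟨_, h2, _, _, h5, _⟩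
        exact hs ⟨h5, h2⟩
    · rw [Set.indicator_of_notMem ht]
      convert lintegral_zero with s
      convert measure_empty (μ := (volume : Measure ((Fin n → ℝ) × (Fin n → ℝ)))) using 2
      ext z
      simp only [ccfT, Set.mem_preimage, Set.mem_ofPred_eq, Set.mem_empty_iff_false, iff_false]
      rintro ⟨_, _, h3, h4, _⟩
      exact ht ⟨h3, h4⟩

lemma ccf_lambdaVol (n : ℕ) (x : ℝ) (hx : 0 ≤ x) : lambdaVol n (2 * x) 0 =
    x ^ (2 * n) * (1 / (n.factorial * (n + 1).factorial)) := by
  have h : LambdaSet n (2 * x) 0 = ccfL n x x := by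
    simp [LambdaSet, ccfL]
  rw [lambdaVol, h, ccf_vol n x x hx le_rfl, ENNReal.toReal_ofReal (ccfV_nonneg n x x hx le_rfl)]
  cases n with
  | zero => simp [ccfV]
  | succ n =>
    rw [ccfV, Nat.factorial_succ (n + 1)]
    have := Nat.factorial_ne_zero (n + 1)
    push_cast
    try simp only [add_tsub_cancel_right]
    field_simp
    ring

lemma ccf_summable (x : ℝ) (hx : 0 ≤ x) : Summable (fun n : ℕ => lambdaVol n (2 * x) 0) := by
  refine Summable.of_nonneg_of_le (fun n => ?_) (fun n => ?_)
    (Real.summable_pow_div_factorial (x ^ 2))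
  · exact ENNReal.toReal_nonneg
  · rw [ccf_lambdaVol n x hx, pow_mul, mul_one_div]
    have : (1 : ℝ) ≤ (n + 1).factorial := by exact_mod_cast Nat.factorial_pos (n + 1)
    have h2 : (0 : ℝ) < n.factorial := by exact_mod_cast Nat.factorial_pos n
    gcongr
    nlinarith
/-- explicit power-series formula for the continuous Catalan
function `C(2x)`; the sum over `m ≥ 2` is written as a sum over `j : ℕ` with
`m = j + 2`, and the sum over `k + l = m − 2` as a sum over `k ≤ j` with
`l = j − k`. -/
theorem catalanFun_two_x (x : ℝ) (hx : 0 ≤ x) :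
    catalanFun (2 * x) =
      1 + ∑' j : ℕ,
        (∑ k ∈ Finset.range (j + 1),
          ((∑ n ∈ Finset.range (j - k + 1), (Icoef n k (j - k) : ℝ)) *
            ∑ p ∈ Finset.range (k + 2),
              (-1 : ℝ) ^ (k + 1 - p) * (Nat.choose (j + 2) p : ℝ) *
                (Nat.choose (j + 1 - p) (j - k) : ℝ))) *
          x ^ (j + 2) / (Nat.factorial (j + 2) : ℝ) := by
  change _ = 1 + ∑' j : ℕ, ccfCoef j * x ^ (j + 2) / (Nat.factorial (j + 2) : ℝ)
  rw [catalanFun, (ccf_summable x hx).tsum_eq_zero_add]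
  congr 1
  · simp [ccf_lambdaVol 0 x hx]
  · have hinj : Function.Injective (fun N : ℕ => 2 * N) := fun a b h => by
      simpa using h
    rw [← hinj.tsum_eq (f := fun j : ℕ => ccfCoef j * x ^ (j + 2) / (Nat.factorial (j + 2) : ℝ))]
    · refine tsum_congr fun N => ?_
      rw [ccf_lambdaVol (N + 1) x hx, ccf_coef_even, ← ccf_cat]
      rw [show 2 * (N + 1) = 2 * N + 2 by ring]
      ring
    · intro j hj
      rw [Function.mem_support] at hj
      by_contra hn
      apply hj
      rw [ccf_coef_odd j, zero_mul, zero_div]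
      rintro ⟨r, rfl⟩
      exact hn ⟨r, by simp; ring⟩
end
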